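/- Let u ∈ 𝒦 with corresponding closed set E ⊆ (−∞,0], and let E* = {x > 0 : −x ∈ E}. Then the order of u satisfies ρ(u) ≥ (1/2)·Λ̄(E*) and the lower order satisfies λ(u) ≥ (1/2)·Λ_(E*), where Λ̄ and Λ_ denote upper and lower logarithmic density. -/

import Mathlib

open Filter Metric Real MeasureTheory

/-- The sub-mean-value property on circles; with continuity this expresses
that `u` is subharmonic in `ℂ`. -/
def Submean (u : ℂ → ℝ) : Prop :=
  ∀ (z : ℂ) (ρ : ℝ), 0 < ρ →
    u z ≤ (1 / (2 * π)) * ∫ θ in (0:ℝ)..(2 * π), u (z + ρ * Complex.exp (θ * Complex.I))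

/-- Mean-value equality on all circles whose closed discs lie in `D`; this expresses
that `u` is harmonic on `D`. -/
def HarmonicMeanOn (u : ℂ → ℝ) (D : Set ℂ) : Prop :=
  ∀ z ∈ D, ∀ ρ : ℝ, 0 < ρ → closedBall z ρ ⊆ D →
    u z = (1 / (2 * π)) * ∫ θ in (0:ℝ)..(2 * π), u (z + ρ * Complex.exp (θ * Complex.I))

/-- `B(r,u) = max_{|z|=r} u(z)`. -/
noncomputable def Bmax (u : ℂ → ℝ) (r : ℝ) : ℝ := sSup (u '' sphere (0 : ℂ) r)

/-- `A(r,u) = min_{|z|=r} u(z)`. -/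
noncomputable def Amin (u : ℂ → ℝ) (r : ℝ) : ℝ := sInf (u '' sphere (0 : ℂ) r)

/-- The class `𝒦`: `u` is continuous and subharmonic in `ℂ`, positive and harmonic
in `ℂ \ E`, where `E ⊆ (-∞, 0]` is a closed set on which `u` vanishes; `u` is
symmetric in the real axis. -/
structure ClassK (u : ℂ → ℝ) (E : Set ℂ) : Prop where
  closed : IsClosed E
  subNegAxis : E ⊆ {z : ℂ | z.im = 0 ∧ z.re ≤ 0}
  cont : Continuous u
  submean : Submean u
  vanish : ∀ z ∈ E, u z = 0
  pos : ∀ z ∉ E, 0 < u z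
  harm : HarmonicMeanOn u Eᶜ
  symm : ∀ z : ℂ, u ((starRingEnd ℂ) z) = u z

/-- Upper logarithmic density of a set `S ⊆ (0,∞)`. -/
noncomputable def upperLogDens (S : Set ℝ) : ℝ :=
  limsup (fun r => (1 / Real.log r) * ∫ t in S ∩ Set.Ioo 1 r, 1 / t) atTop

/-- Lower logarithmic density of a set `S ⊆ (0,∞)`. -/
noncomputable def lowerLogDens (S : Set ℝ) : ℝ :=
  liminf (fun r => (1 / Real.log r) * ∫ t in S ∩ Set.Ioo 1 r, 1 / t) atTop

open InnerProductSpace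

/-- Polar coordinates for continuous functions vanishing outside a disc. -/
theorem integral_eq_polar {g : ℂ → ℝ} (hg : Continuous g) {R : ℝ} (hR : 0 ≤ R)
    (h0 : ∀ z, R ≤ ‖z‖ → g z = 0) :
    ∫ z, g z = ∫ r in (0:ℝ)..R, r * ∫ θ in (-π)..π, g (r * Complex.exp (θ * Complex.I)) := by
  rw [← Complex.integral_comp_polarCoord_symm]
  have hpt : ∀ p : ℝ × ℝ, Complex.polarCoord.symm p = p.1 * Complex.exp (p.2 * Complex.I) := by
    intro p
    rw [Complex.polarCoord_symm_apply, Complex.exp_mul_I, Complex.ofReal_cos, Complex.ofReal_sin]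
  simp_rw [hpt, smul_eq_mul]
  have hcont : Continuous fun p : ℝ × ℝ => p.1 * g (p.1 * Complex.exp (p.2 * Complex.I)) := by
    fun_prop
  have hsub : Set.Ioc 0 R ×ˢ Set.Ioo (-π) π ⊆ polarCoord.target := by
    intro p hp
    exact ⟨hp.1.1, hp.2⟩
  have hrestr : ∫ p in polarCoord.target, p.1 * g (p.1 * Complex.exp (p.2 * Complex.I)) =
      ∫ p in Set.Ioc 0 R ×ˢ Set.Ioo (-π) π, p.1 * g (p.1 * Complex.exp (p.2 * Complex.I)) := by
    apply setIntegral_eq_of_subset_of_forall_sdiff_eq_zero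
      polarCoord.open_target.measurableSet hsub
    intro p hp
    have hp1 : 0 < p.1 := hp.1.1
    have hp2 : R ≤ p.1 := by
      by_contra hlt
      exact hp.2 ⟨⟨hp1, (not_le.1 hlt).le⟩, hp.1.2⟩
    rw [h0, mul_zero]
    rw [norm_mul, Complex.norm_exp_ofReal_mul_I, mul_one, Complex.norm_real, Real.norm_eq_abs]
    exact hp2.trans (le_abs_self _)
  rw [hrestr, intervalIntegral.integral_of_le hR, Measure.volume_eq_prod, setIntegral_prod]
  · apply integral_congr_ae
    filter_upwards with r
    rw [intervalIntegral.integral_of_le (by linarith [pi_pos]), integral_Ioc_eq_integral_Ioo,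
      integral_const_mul]
  · refine (hcont.continuousOn.integrableOn_compact
      (isCompact_Icc (a := (0 : ℝ)) (b := R) |>.prod (isCompact_Icc (a := -π) (b := π)))).mono_set ?_
    exact Set.prod_mono Set.Ioc_subset_Icc_self Set.Ioo_subset_Icc_self

theorem integral_circle_shift {v : ℂ → ℝ} (z : ℂ) (r : ℝ) (a : ℝ) :
    ∫ θ in a..(a + 2 * π), v (z + r * Complex.exp (θ * Complex.I)) =
      ∫ θ in (0:ℝ)..(2 * π), v (z + r * Complex.exp (θ * Complex.I)) := by
  have hper : Function.Periodic (fun θ : ℝ => v (z + r * Complex.exp (θ * Complex.I))) (2 * π) := by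
    intro θ
    simp only
    push_cast
    rw [add_mul, Complex.exp_periodic]
  have := hper.intervalIntegral_add_eq a 0
  rwa [zero_add] at this

theorem integral_radial_mul {v : ℂ → ℝ} (hv : Continuous v) {χ : ℝ → ℝ} (hχ : Continuous χ) {R : ℝ}
    (hR : 0 ≤ R) (h0 : ∀ s, R ≤ s → χ s = 0) (z : ℂ) :
    ∫ ζ, χ ‖ζ‖ * v (z + ζ) = ∫ r in (0:ℝ)..R, r * χ r *
      ∫ θ in (0:ℝ)..(2 * π), v (z + r * Complex.exp (θ * Complex.I)) := by
  rw [integral_eq_polar (R := R) (by fun_prop) hR (fun w hw => by rw [h0 _ hw, zero_mul])]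
  apply intervalIntegral.integral_congr
  intro r hr
  rw [Set.uIcc_of_le hR] at hr
  have hn : ∀ θ : ℝ, ‖(r : ℂ) * Complex.exp (θ * Complex.I)‖ = r := by
    intro θ
    rw [norm_mul, Complex.norm_exp_ofReal_mul_I, mul_one, Complex.norm_real, Real.norm_eq_abs,
      abs_of_nonneg hr.1]
  simp only [hn]
  rw [intervalIntegral.integral_const_mul, ← mul_assoc]
  congr 1
  rw [← integral_circle_shift z r (-π)]
  congr 1
  ring

theorem integral_radial_mul_eq {v : ℂ → ℝ} (hv : Continuous v) {χ : ℝ → ℝ} (hχ : Continuous χ)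
    {R : ℝ} (hR : 0 ≤ R) (h0 : ∀ s, R ≤ s → χ s = 0) (z : ℂ)
    (hmean : ∀ ρ, 0 < ρ → ρ ≤ R → v z =
      (1 / (2 * π)) * ∫ θ in (0:ℝ)..(2 * π), v (z + ρ * Complex.exp (θ * Complex.I))) :
    ∫ ζ, χ ‖ζ‖ * v (z + ζ) = v z * (2 * π * ∫ r in (0:ℝ)..R, r * χ r) := by
  rw [integral_radial_mul hv hχ hR h0, ← intervalIntegral.integral_const_mul,
    ← intervalIntegral.integral_const_mul]
  apply intervalIntegral.integral_congr
  intro r hr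
  rw [Set.uIcc_of_le hR] at hr
  rcases hr.1.eq_or_lt with h | h
  · simp [← h]
  · simp only
    rw [hmean r h hr.2]
    generalize (∫ θ in (0:ℝ)..(2 * π), v (z + r * Complex.exp (θ * Complex.I))) = I
    field_simp

theorem le_integral_radial_mul {v : ℂ → ℝ} (hv : Continuous v) {χ : ℝ → ℝ} (hχ : Continuous χ)
    {R : ℝ} (hR : 0 ≤ R) (h0 : ∀ s, R ≤ s → χ s = 0) (hχ0 : ∀ s, 0 ≤ χ s) (hs : Submean v) (z : ℂ) :
    v z * (2 * π * ∫ r in (0:ℝ)..R, r * χ r) ≤ ∫ ζ, χ ‖ζ‖ * v (z + ζ) := by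
  rw [integral_radial_mul hv hχ hR h0, ← intervalIntegral.integral_const_mul,
    ← intervalIntegral.integral_const_mul]
  have hc : Continuous fun r : ℝ =>
      ∫ θ in (0:ℝ)..(2 * π), v (z + r * Complex.exp (θ * Complex.I)) :=
    intervalIntegral.continuous_parametric_intervalIntegral_of_continuous' (by fun_prop) _ _
  apply intervalIntegral.integral_mono_on hR
  · exact Continuous.intervalIntegrable (by fun_prop) _ _
  · exact Continuous.intervalIntegrable (by fun_prop) _ _
  intro r hr
  rcases hr.1.eq_or_lt with h | h
  · simp [← h]
  · have h1 := mul_le_mul_of_nonneg_left (hs z r h)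
      (show 0 ≤ 2 * π * (r * χ r) from by have := hχ0 r; positivity)
    calc _ = 2 * π * (r * χ r) * v z := by ring
      _ ≤ _ := h1
      _ = _ := by
        generalize (∫ θ in (0:ℝ)..(2 * π), v (z + r * Complex.exp (θ * Complex.I))) = I
        field_simp

/-- Continuous functions with the mean value property are smooth. -/
theorem HarmonicMeanOn.contDiffAt {u : ℂ → ℝ} {D : Set ℂ} (h : HarmonicMeanOn u D)
    (hu : Continuous u) (hD : IsOpen D) {z : ℂ} (hz : z ∈ D) : ContDiffAt ℝ 2 u z := by
  obtain ⟨ε, hε, hball⟩ := Metric.isOpen_iff.1 hD z hz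
  set R := ε / 3 with hRdef
  have hR : 0 < R := by positivity
  let χ : ℝ → ℝ := fun s => expNegInvGlue (R ^ 2 - s ^ 2)
  have hχ : Continuous χ := by
    have := (expNegInvGlue.contDiff (n := 0)).continuous
    fun_prop
  have hχ0 : ∀ s, R ≤ s → χ s = 0 := fun s hs =>
    expNegInvGlue.zero_of_nonpos (by nlinarith)
  set m := 2 * π * ∫ r in (0:ℝ)..R, r * χ r with hm
  have hmpos : 0 < m := by
    refine mul_pos (by positivity) (intervalIntegral.intervalIntegral_pos_of_pos_on ?_ ?_ hR)
    · exact Continuous.intervalIntegrable (by fun_prop) _ _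
    · intro s hs
      exact mul_pos hs.1 (expNegInvGlue.pos_of_pos (by nlinarith [hs.1, hs.2]))
  have hsmooth : ContDiff ℝ 2 fun ζ : ℂ => χ ‖ζ‖ := by
    have h1 : ContDiff ℝ 2 fun ζ : ℂ => R ^ 2 - ‖ζ‖ ^ 2 := contDiff_const.sub (contDiff_norm_sq ℝ)
    exact (expNegInvGlue.contDiff (n := 2)).comp h1
  have hsupp : HasCompactSupport fun ζ : ℂ => χ ‖ζ‖ := by
    refine HasCompactSupport.intro (isCompact_closedBall (0 : ℂ) R) fun x hx => hχ0 _ ?_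
    simpa using (not_le.1 (fun h => hx (by simpa using h))).le
  have hconv := hsupp.contDiff_convolution_left (n := 2) (ContinuousLinearMap.mul ℝ ℝ) (μ := volume)
    hsmooth hu.locallyIntegrable
  have heq : u =ᶠ[nhds z] fun x => m⁻¹ *
      (convolution (fun ζ : ℂ => χ ‖ζ‖) u (ContinuousLinearMap.mul ℝ ℝ) volume) x := by
    filter_upwards [Metric.ball_mem_nhds z hR] with x hx
    have hxD : ∀ ρ, 0 < ρ → ρ ≤ R → closedBall x ρ ⊆ D := fun ρ _ hρR y hy => hball <| by
      have h1 : dist y x ≤ R := le_trans hy hρR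
      have h2 : dist x z < R := hx
      have h3 := dist_triangle y x z
      rw [mem_ball]
      linarith
    have hintegral := integral_radial_mul_eq hu hχ hR.le hχ0 x fun ρ hρ hρR =>
      h x (hxD ρ hρ hρR (mem_closedBall_self hρ.le)) ρ hρ (hxD ρ hρ hρR)
    rw [← hm] at hintegral
    have hcv : (convolution (fun ζ : ℂ => χ ‖ζ‖) u (ContinuousLinearMap.mul ℝ ℝ) volume) x =
        ∫ ζ, χ ‖ζ‖ * u (x + ζ) := by
      rw [convolution_def, ← integral_neg_eq_self]
      simp
    rw [hcv, hintegral]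
    field_simp
  exact (contDiff_const.mul hconv).contDiffAt.congr_of_eventuallyEq heq

/-- Differentiation under an interval integral with jointly continuous derivative. -/
theorem hasDerivAt_intervalIntegral_of_continuousOn {f f' : ℝ → ℝ → ℝ} {s : Set ℝ} {a b x₀ : ℝ}
    (hs : IsOpen s) (hx₀ : x₀ ∈ s) (hf : ∀ x ∈ s, ∀ θ ∈ Set.uIcc a b, HasDerivAt (f · θ) (f' x θ) x)
    (hfc : ∀ x ∈ s, ContinuousOn (f x) (Set.uIcc a b))
    (hf' : ContinuousOn (Function.uncurry f') (s ×ˢ Set.uIcc a b)) :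
    HasDerivAt (fun x => ∫ θ in a..b, f x θ) (∫ θ in a..b, f' x₀ θ) x₀ := by
  obtain ⟨ε, hε, hball⟩ := Metric.isOpen_iff.1 hs x₀ hx₀
  have hsub : closedBall x₀ (ε / 2) ⊆ s := (closedBall_subset_ball (by linarith)).trans hball
  have hcomp : IsCompact (closedBall x₀ (ε / 2) ×ˢ Set.uIcc a b) :=
    (isCompact_closedBall _ _).prod isCompact_uIcc
  obtain ⟨C, hC⟩ := hcomp.exists_bound_of_continuousOn
    (hf'.mono (Set.prod_mono hsub Set.Subset.rfl))
  have hf'c : ContinuousOn (f' x₀) (Set.uIcc a b) :=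
    hf'.comp (f := fun θ => (x₀, θ)) (by fun_prop) fun θ hθ => ⟨hx₀, hθ⟩
  refine (intervalIntegral.hasDerivAt_integral_of_dominated_loc_of_deriv_le
    (s := closedBall x₀ (ε / 2)) (bound := fun _ => C)
    (closedBall_mem_nhds x₀ (by positivity)) ?_ ?_ ?_ ?_ ?_ ?_).2
  · filter_upwards [hs.mem_nhds hx₀] with x hx
    exact ((hfc x hx).mono Set.uIoc_subset_uIcc).aestronglyMeasurable measurableSet_uIoc
  · exact (hfc x₀ hx₀).intervalIntegrable
  · exact (hf'c.mono Set.uIoc_subset_uIcc).aestronglyMeasurable measurableSet_uIoc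
  · filter_upwards with θ hθ x hx
    exact hC (x, θ) ⟨hx, Set.uIoc_subset_uIcc hθ⟩
  · exact intervalIntegrable_const
  · filter_upwards with θ hθ x hx
    exact hf x (hsub hx) θ (Set.uIoc_subset_uIcc hθ)

theorem hasDerivAt_fderiv_apply {u : ℂ → ℝ} {c : ℝ → ℂ} {x : ℝ} {v : ℂ}
    (hu : ContDiffAt ℝ 2 u (c x)) (hc : HasDerivAt c v x) (w : ℂ) :
    HasDerivAt (fun y => fderiv ℝ u (c y) w) (fderiv ℝ (fderiv ℝ u) (c x) v w) x := by
  have h1 : HasFDerivAt (fderiv ℝ u) (fderiv ℝ (fderiv ℝ u) (c x)) (c x) :=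
    ((hu.fderiv_right (m := 1) (by norm_num)).differentiableAt (by norm_num)).hasFDerivAt
  have h2 : HasDerivAt (fun y => fderiv ℝ u (c y)) (fderiv ℝ (fderiv ℝ u) (c x) v) x :=
    h1.comp_hasDerivAt x hc
  have h3 := h2.clm_apply (hasDerivAt_const x w)
  simpa using h3


/-- The mean value property implies harmonicity. -/
theorem HarmonicMeanOn.harmonicOnNhd {u : ℂ → ℝ} {D : Set ℂ} (h : HarmonicMeanOn u D)
    (hu : Continuous u) (hD : IsOpen D) : HarmonicOnNhd u D := by
  have hlap : ∀ z ∈ D, Laplacian.laplacian u z = 0 := by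
    intro z hz
    obtain ⟨ε, hε, hball⟩ := Metric.isOpen_iff.1 hD z hz
    let e : ℝ → ℂ := fun θ => Complex.exp (θ * Complex.I)
    have he : Continuous e := by fun_prop
    have hne : ∀ θ, ‖e θ‖ = 1 := fun θ => Complex.norm_exp_ofReal_mul_I θ
    have hin : ∀ ρ ∈ Set.Ioo (-ε) ε, ∀ θ, z + ρ * e θ ∈ D := by
      intro ρ hρ θ
      apply hball
      rw [mem_ball, dist_eq_norm, add_sub_cancel_left, norm_mul, hne, mul_one, Complex.norm_real,
        Real.norm_eq_abs]
      exact abs_lt.2 hρ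
    have hcd : ContDiffOn ℝ 2 u D := fun x hx => (h.contDiffAt hu hD hx).contDiffWithinAt
    have hline : ∀ θ ρ : ℝ, HasDerivAt (fun ρ : ℝ => z + ρ * e θ) (e θ) ρ := by
      intro θ ρ
      have h1 := ((Complex.ofRealCLM.hasDerivAt (x := ρ)).mul_const (e θ)).const_add z
      simpa using h1
    have hdiff : ∀ x ∈ D, HasFDerivAt u (fderiv ℝ u x) x := fun x hx =>
      ((h.contDiffAt hu hD hx).differentiableAt (by norm_num)).hasFDerivAt
    have hdiff2 : ∀ x ∈ D, HasFDerivAt (fderiv ℝ u) (fderiv ℝ (fderiv ℝ u) x) x := fun x hx =>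
      (((h.contDiffAt hu hD hx).fderiv_right (m := 1) (by norm_num)).differentiableAt
        (by norm_num)).hasFDerivAt
    have hc1 : ContinuousOn (fderiv ℝ u) D := fun x hx =>
      ((hdiff2 x hx).continuousAt).continuousWithinAt
    have hc2 : ContinuousOn (fderiv ℝ (fderiv ℝ u)) D := fun x hx =>
      (((h.contDiffAt hu hD hx).fderiv_right (m := 1) (by norm_num)).fderiv_right
        (m := 0) (by norm_num)).continuousAt.continuousWithinAt
    have hz0 : (0:ℝ) ∈ Set.Ioo (-ε) ε := ⟨by linarith, hε⟩
    have hmaps : Set.MapsTo (fun p : ℝ × ℝ => z + p.1 * e p.2)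
        (Set.Ioo (-ε) ε ×ˢ Set.uIcc 0 (2 * π)) D := fun p hp => hin p.1 hp.1 p.2
    have hd1 : ∀ ρ ∈ Set.Ioo (-ε) ε, HasDerivAt
        (fun ρ : ℝ => ∫ θ in (0:ℝ)..(2 * π), u (z + ρ * e θ))
        (∫ θ in (0:ℝ)..(2 * π), fderiv ℝ u (z + ρ * e θ) (e θ)) ρ := by
      intro ρ hρ
      apply hasDerivAt_intervalIntegral_of_continuousOn isOpen_Ioo hρ
        (f' := fun ρ θ => fderiv ℝ u (z + ρ * e θ) (e θ))
      · intro x hx θ _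
        exact (hdiff _ (hin x hx θ)).comp_hasDerivAt x (hline θ x)
      · intro x hx
        fun_prop
      · exact (hc1.comp (by fun_prop) hmaps).clm_apply (by fun_prop)
    have hd2 : HasDerivAt
        (fun ρ : ℝ => ∫ θ in (0:ℝ)..(2 * π), fderiv ℝ u (z + ρ * e θ) (e θ))
        (∫ θ in (0:ℝ)..(2 * π), fderiv ℝ (fderiv ℝ u) (z + (0:ℝ) * e θ) (e θ) (e θ)) 0 := by
      apply hasDerivAt_intervalIntegral_of_continuousOn isOpen_Ioo hz0
        (f' := fun ρ θ => fderiv ℝ (fderiv ℝ u) (z + ρ * e θ) (e θ) (e θ))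
      · intro x hx θ _
        exact hasDerivAt_fderiv_apply (c := fun y : ℝ => z + y * e θ) (h.contDiffAt hu hD (hin x hx θ))
          (hline θ x) (e θ)
      · intro x hx
        refine ContinuousOn.clm_apply (hc1.comp (by fun_prop) fun θ _ => hin x hx θ) (by fun_prop)
      · exact ((hc2.comp (by fun_prop) hmaps).clm_apply (by fun_prop)).clm_apply (by fun_prop)
    set g : ℝ → ℝ := fun ρ => ∫ θ in (0:ℝ)..(2 * π), fderiv ℝ u (z + ρ * e θ) (e θ) with hg
    have hgpos : ∀ ρ ∈ Set.Ioo 0 ε, g ρ = 0 := by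
      intro ρ hρ
      have h1 := hd1 ρ ⟨by linarith [hρ.1], hρ.2⟩
      refine h1.unique ((hasDerivAt_const ρ (2 * π * u z)).congr_of_eventuallyEq ?_)
      filter_upwards [Ioo_mem_nhds hρ.1 hρ.2] with x hx
      rw [h z hz x hx.1 ((closedBall_subset_ball hx.2).trans hball)]
      change (∫ θ in (0:ℝ)..(2 * π), u (z + x * e θ)) =
        2 * π * (1 / (2 * π) * ∫ θ in (0:ℝ)..(2 * π), u (z + x * e θ))
      generalize (∫ θ in (0:ℝ)..(2 * π), u (z + x * e θ)) = I
      field_simp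
    have hev : ∀ᶠ ρ in nhdsWithin (0:ℝ) (Set.Ioi 0), g ρ = 0 := by
      filter_upwards [Ioo_mem_nhdsGT hε] with ρ hρ using hgpos ρ hρ
    have hg0 : g 0 = 0 := by
      have h1 : Tendsto g (nhdsWithin (0:ℝ) (Set.Ioi 0)) (nhds (g 0)) :=
        hd2.continuousAt.tendsto.mono_left nhdsWithin_le_nhds
      exact tendsto_nhds_unique h1 (tendsto_const_nhds.congr' (hev.mono fun _ h => h.symm))
    have hintegral : (∫ θ in (0:ℝ)..(2 * π), fderiv ℝ (fderiv ℝ u) (z + (0:ℝ) * e θ) (e θ) (e θ)) = 0 := by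
      refine (uniqueDiffWithinAt_Ioi (0:ℝ)).eq_deriv _ hd2.hasDerivWithinAt ?_
      exact (hasDerivWithinAt_const (0:ℝ) (Set.Ioi 0) (0:ℝ)).congr_of_eventuallyEq hev hg0
    set A := fderiv ℝ (fderiv ℝ u) z with hA
    have hexp : ∀ θ : ℝ, fderiv ℝ (fderiv ℝ u) (z + (0:ℝ) * e θ) (e θ) (e θ) =
        A 1 1 * cos θ ^ 2 + (A 1 Complex.I + A Complex.I 1) * (sin θ * cos θ) +
          A Complex.I Complex.I * sin θ ^ 2 := by
      intro θ
      have h1 : e θ = (cos θ) • (1 : ℂ) + (sin θ) • Complex.I := by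
        simp only [e, Complex.exp_mul_I, Complex.real_smul, mul_one, Complex.ofReal_cos,
          Complex.ofReal_sin]
      rw [Complex.ofReal_zero, zero_mul, add_zero, ← hA, h1]
      simp only [map_add, map_smul, _root_.add_apply, _root_.smul_apply,
        smul_eq_mul]
      ring
    simp_rw [hexp] at hintegral
    rw [intervalIntegral.integral_add, intervalIntegral.integral_add,
      intervalIntegral.integral_const_mul, intervalIntegral.integral_const_mul,
      intervalIntegral.integral_const_mul, integral_cos_sq, integral_sin_sq,
      integral_sin_mul_cos₁] at hintegral
    · simp only [sin_two_pi, cos_two_pi, sin_zero, cos_zero] at hintegral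
      rw [laplacian_eq_iteratedFDeriv_complexPlane]
      simp only [iteratedFDeriv_two_apply, Matrix.cons_val_zero, Matrix.cons_val_one, ← hA]
      have : π * (A 1 1 + A Complex.I Complex.I) = 0 := by linarith
      exact (mul_eq_zero.1 this).resolve_left pi_ne_zero
    all_goals exact Continuous.intervalIntegrable (by fun_prop) _ _
  intro z hz
  exact ⟨h.contDiffAt hu hD hz, by
    filter_upwards [hD.mem_nhds hz] with x hx using hlap x hx⟩

theorem harmonicAt_comp_exp {u : ℂ → ℝ} (hu : HarmonicOnNhd u Complex.slitPlane) {w : ℂ}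
    (hw : |w.im| < π) : HarmonicAt (fun z => u (Complex.exp z)) w := by
  have hmem : Complex.exp w ∈ Complex.slitPlane := by
    have hs := abs_lt.1 hw
    rw [Complex.exp_mem_slitPlane, (toIocMod_eq_self two_pi_pos).2 ⟨hs.1, by linarith⟩]
    exact hs.2.ne
  obtain ⟨ε, hε, hball⟩ := Metric.isOpen_iff.1 Complex.isOpen_slitPlane _ hmem
  obtain ⟨F, hF, hFu⟩ := (hu.mono hball).exists_analyticOnNhd_ball_re_eq
  have h1 : HarmonicAt (fun z => (F (Complex.exp z)).re) w :=
    AnalyticAt.harmonicAt_re (f := fun z => F (Complex.exp z))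
      ((hF _ (mem_ball_self hε)).comp analyticAt_cexp)
  refine (harmonicAt_congr_nhds ?_).1 h1
  filter_upwards [Complex.continuous_exp.continuousAt.preimage_mem_nhds (ball_mem_nhds _ hε)]
    with z hz using hFu hz

/-- The angular average of `U` on the vertical segment through `t`, with weight `w`, dilated by
`κ`. -/
noncomputable def stripMean (U : ℂ → ℝ) (w : ℝ → ℝ) (κ t : ℝ) : ℝ :=
  ∫ φ in (-π)..π, U (t + (κ * φ : ℝ) * Complex.I) * w φ

theorem continuous_stripMean {U : ℂ → ℝ} {w : ℝ → ℝ} (hU : Continuous U) (hw : Continuous w) :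
    Continuous fun p : ℝ × ℝ => stripMean U w p.1 p.2 := by
  unfold stripMean
  exact intervalIntegral.continuous_parametric_intervalIntegral_of_continuous' (by fun_prop) _ _

/-- The right-hand side of the second-order equation satisfied by `stripMean`. -/
noncomputable def stripSource (U : ℂ → ℝ) (w' w'' : ℝ → ℝ) (κ t : ℝ) : ℝ :=
  U (t + (κ * π : ℝ) * Complex.I) * w' π - U (t + (κ * -π : ℝ) * Complex.I) * w' (-π) -
    stripMean U w'' κ t

theorem continuous_stripSource {U : ℂ → ℝ} {w' w'' : ℝ → ℝ} (hU : Continuous U)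
    (hw : Continuous w'') : Continuous fun p : ℝ × ℝ => stripSource U w' w'' p.1 p.2 := by
  have := continuous_stripMean hU hw
  unfold stripSource
  fun_prop

theorem stripMean_deriv_inner {U : ℂ → ℝ} (hU : Continuous U)
    (hH : ∀ z : ℂ, |z.im| < π → HarmonicAt U z) {w w' w'' : ℝ → ℝ}
    (hw : ∀ x, HasDerivAt w (w' x) x) (hw' : ∀ x, HasDerivAt w' (w'' x) x)
    (hw'' : Continuous w'') (h1 : w π = 0) (h2 : w (-π) = 0) {κ : ℝ} (hκ : κ ∈ Set.Ioo (0:ℝ) 1) :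
    ∃ K' : ℝ → ℝ, ∀ t, HasDerivAt (stripMean U w κ) (K' t) t ∧
      HasDerivAt K' (stripSource U w' w'' κ t / κ ^ 2) t := by
  let c : ℝ → ℝ → ℂ := fun t φ => t + (κ * φ : ℝ) * Complex.I
  have hwc : Continuous w := continuous_iff_continuousAt.2 fun x => (hw x).continuousAt
  have hwc' : Continuous w' := continuous_iff_continuousAt.2 fun x => (hw' x).continuousAt
  have hin : ∀ t, ∀ φ ∈ Set.uIcc (-π) π, |(c t φ).im| < π := by
    intro t φ hφ
    rw [Set.uIcc_of_le (by linarith [pi_pos])] at hφ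
    have : (c t φ).im = κ * φ := by simp [c]
    rw [this, abs_mul, abs_of_pos hκ.1]
    have h3 : |φ| ≤ π := abs_le.2 hφ
    nlinarith [hκ.1, hκ.2, pi_pos, abs_nonneg φ]
  let D : Set ℂ := {z | |z.im| < π}
  have hc1 : ContinuousOn (fderiv ℝ U) D := fun x hx =>
    ((hH x hx).1.fderiv_right (m := 1) (by norm_num)).continuousAt.continuousWithinAt
  have hc2 : ContinuousOn (fderiv ℝ (fderiv ℝ U)) D := fun x hx =>
    (((hH x hx).1.fderiv_right (m := 1) (by norm_num)).fderiv_right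
      (m := 0) (by norm_num)).continuousAt.continuousWithinAt
  have hlap : ∀ z ∈ D, fderiv ℝ (fderiv ℝ U) z 1 1 =
      -fderiv ℝ (fderiv ℝ U) z Complex.I Complex.I := by
    intro z hz
    have h3 := (hH z hz).2.self_of_nhds
    rw [laplacian_eq_iteratedFDeriv_complexPlane] at h3
    simp only [iteratedFDeriv_two_apply, Matrix.cons_val_zero, Matrix.cons_val_one,
      Pi.zero_apply] at h3
    linarith
  have hct : ∀ t φ : ℝ, HasDerivAt (fun t => c t φ) 1 t := by
    intro t φ
    simpa [c] using (Complex.ofRealCLM.hasDerivAt (x := t)).add_const ((κ * φ : ℝ) * Complex.I)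
  have hcφ : ∀ t φ : ℝ, HasDerivAt (fun φ => c t φ) (κ * Complex.I) φ := by
    intro t φ
    have h3 := (((Complex.ofRealCLM.hasDerivAt (x := φ)).const_mul (κ : ℂ)).mul_const
      Complex.I).const_add (t : ℂ)
    simpa [c] using h3
  have hmaps : Set.MapsTo (fun p : ℝ × ℝ => c p.1 p.2) (Set.univ ×ˢ Set.uIcc (-π) π) D :=
    fun p hp => hin p.1 p.2 hp.2
  have hcc : Continuous fun p : ℝ × ℝ => c p.1 p.2 := by fun_prop
  refine ⟨fun t => ∫ φ in (-π)..π, fderiv ℝ U (c t φ) 1 * w φ, fun t => ⟨?_, ?_⟩⟩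
  · apply hasDerivAt_intervalIntegral_of_continuousOn isOpen_univ (Set.mem_univ t)
      (f' := fun t φ => fderiv ℝ U (c t φ) 1 * w φ)
    · intro x _ φ hφ
      exact (((hH _ (hin x φ hφ)).1.differentiableAt (by norm_num)).hasFDerivAt.comp_hasDerivAt x
        (hct x φ)).mul_const _
    · intro x _
      fun_prop
    · exact ((hc1.comp hcc.continuousOn hmaps).clm_apply continuousOn_const).mul
        (by fun_prop)
  · have key : stripSource U w' w'' κ t / κ ^ 2 =
        ∫ φ in (-π)..π, fderiv ℝ (fderiv ℝ U) (c t φ) 1 1 * w φ := by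
      have hκI : ((κ : ℂ) * Complex.I) = κ • Complex.I := by rw [Complex.real_smul]
      have hV1 : ∀ φ ∈ Set.uIcc (-π) π, HasDerivAt (fun φ => U (c t φ))
          (fderiv ℝ U (c t φ) (κ * Complex.I)) φ := fun φ hφ =>
        ((hH _ (hin t φ hφ)).1.differentiableAt (by norm_num)).hasFDerivAt.comp_hasDerivAt φ
          (hcφ t φ)
      have hV2 : ∀ φ ∈ Set.uIcc (-π) π, HasDerivAt (fun φ => fderiv ℝ U (c t φ) (κ * Complex.I))
          (fderiv ℝ (fderiv ℝ U) (c t φ) (κ * Complex.I) (κ * Complex.I)) φ := fun φ hφ =>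
        hasDerivAt_fderiv_apply (c := c t) (hH _ (hin t φ hφ)).1 (hcφ t φ) _
      have hV1c : ContinuousOn (fun φ => fderiv ℝ U (c t φ) (κ * Complex.I)) (Set.uIcc (-π) π) :=
        fun φ hφ => (hV2 φ hφ).continuousAt.continuousWithinAt
      have hV2c : ContinuousOn (fun φ => fderiv ℝ (fderiv ℝ U) (c t φ) (κ * Complex.I)
          (κ * Complex.I)) (Set.uIcc (-π) π) :=
        ((hc2.comp (by fun_prop) fun φ hφ => hin t φ hφ).clm_apply continuousOn_const).clm_apply
          continuousOn_const
      have hp1 := intervalIntegral.integral_mul_deriv_eq_deriv_mul (fun x _ => hw x) hV2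
        (hwc'.intervalIntegrable _ _) hV2c.intervalIntegrable
      have hp2 := intervalIntegral.integral_mul_deriv_eq_deriv_mul (fun x _ => hw' x) hV1
        (hw''.intervalIntegrable _ _) hV1c.intervalIntegrable
      rw [hp2, h1, h2] at hp1
      have hsrc : stripSource U w' w'' κ t = -∫ φ in (-π)..π, w φ *
          fderiv ℝ (fderiv ℝ U) (c t φ) (κ * Complex.I) (κ * Complex.I) := by
        rw [hp1, stripSource, stripMean]
        simp only [mul_comm (w'' _)]
        simp only [c]
        ring
      rw [hsrc, ← intervalIntegral.integral_neg, ← intervalIntegral.integral_div]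
      apply intervalIntegral.integral_congr
      intro φ hφ
      have hκ0 : κ ≠ 0 := hκ.1.ne'
      simp only [hκI, map_smul, _root_.smul_apply, smul_eq_mul, hlap _ (hin t φ hφ)]
      field_simp
    rw [key]
    apply hasDerivAt_intervalIntegral_of_continuousOn isOpen_univ (Set.mem_univ t)
      (f' := fun t φ => fderiv ℝ (fderiv ℝ U) (c t φ) 1 1 * w φ)
    · intro x _ φ hφ
      exact (hasDerivAt_fderiv_apply (c := fun y => c y φ) (hH _ (hin x φ hφ)).1 (hct x φ)
        1).mul_const _
    · intro x _
      refine ContinuousOn.mul (ContinuousOn.clm_apply (hc1.comp (by fun_prop)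
        fun θ hθ => hin x θ hθ) continuousOn_const) (by fun_prop)
    · exact (((hc2.comp hcc.continuousOn hmaps).clm_apply continuousOn_const).clm_apply
        continuousOn_const).mul (by fun_prop)

/-- Taylor's formula with integral remainder at the origin, second order. -/
theorem taylor_two_integral {K K' F : ℝ → ℝ} (hK : ∀ t, HasDerivAt K (K' t) t)
    (hK' : ∀ t, HasDerivAt K' (F t) t) (hF : Continuous F) (t : ℝ) :
    K t - K 0 = t * K' 0 + ∫ s in (0:ℝ)..t, (t - s) * F s := by
  have hKc : Continuous K' := continuous_iff_continuousAt.2 fun x => (hK' x).continuousAt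
  have h1 := intervalIntegral.integral_mul_deriv_eq_deriv_mul (a := 0) (b := t)
    (u := fun s => t - s) (u' := fun _ => -1) (v := K') (v' := F)
    (fun x _ => by simpa using (hasDerivAt_id x).const_sub t) (fun x _ => hK' x)
    (by simp) (hF.intervalIntegrable _ _)
  have h2 := intervalIntegral.integral_eq_sub_of_hasDerivAt (fun x _ => hK x)
    (hKc.intervalIntegrable 0 t)
  rw [h1]
  simp only [neg_mul, one_mul, intervalIntegral.integral_neg, h2]
  ring

/-- The second-order equation for angular averages of a harmonic function on the strip
`|Im z| < π`, continuous up to the boundary. -/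
theorem stripMean_deriv {U : ℂ → ℝ} (hU : Continuous U)
    (hH : ∀ z : ℂ, |z.im| < π → HarmonicAt U z) {w w' w'' : ℝ → ℝ}
    (hw : ∀ x, HasDerivAt w (w' x) x) (hw' : ∀ x, HasDerivAt w' (w'' x) x)
    (hw'' : Continuous w'') (h1 : w π = 0) (h2 : w (-π) = 0) :
    ∃ K' : ℝ → ℝ, ∀ t, HasDerivAt (stripMean U w 1) (K' t) t ∧
      HasDerivAt K' (stripSource U w' w'' 1 t) t := by
  have hwc : Continuous w := continuous_iff_continuousAt.2 fun x => (hw x).continuousAt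
  have hK := continuous_stripMean hU hwc
  have hF := continuous_stripSource (w' := w') hU hw''
  let Φ : ℝ → ℝ → ℝ := fun κ t => κ ^ 2 * (stripMean U w κ t - stripMean U w κ 0) -
    ∫ s in (0:ℝ)..t, (t - s) * stripSource U w' w'' κ s
  have hΦc : ∀ t, Continuous fun κ => Φ κ t := by
    intro t
    have h3 : Continuous fun κ => stripMean U w κ t :=
      hK.comp (by fun_prop : Continuous fun κ : ℝ => (κ, t))
    have h4 : Continuous fun κ => stripMean U w κ 0 :=
      hK.comp (by fun_prop : Continuous fun κ : ℝ => (κ, (0:ℝ)))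
    have h5 : Continuous fun κ => ∫ s in (0:ℝ)..t, (t - s) * stripSource U w' w'' κ s :=
      intervalIntegral.continuous_parametric_intervalIntegral_of_continuous' (by
        have : Continuous fun p : ℝ × ℝ => (t - p.2) * stripSource U w' w'' p.1 p.2 := by fun_prop
        exact this) _ _
    fun_prop
  have hΦ : ∀ κ ∈ Set.Ioo (0:ℝ) 1, ∀ t, Φ κ t = t * Φ κ 1 := by
    intro κ hκ t
    obtain ⟨K', hK'⟩ := stripMean_deriv_inner hU hH hw hw' hw'' h1 h2 hκ
    have hκ0 : κ ≠ 0 := hκ.1.ne'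
    have hFκ : Continuous fun t => stripSource U w' w'' κ t / κ ^ 2 :=
      (hF.comp (by fun_prop : Continuous fun t : ℝ => (κ, t))).div_const _
    have h3 : ∀ t, Φ κ t = t * (κ ^ 2 * K' 0) := by
      intro t
      have h4 := taylor_two_integral (fun t => (hK' t).1) (fun t => (hK' t).2) hFκ t
      have h5 : ∫ s in (0:ℝ)..t, (t - s) * (stripSource U w' w'' κ s / κ ^ 2) =
          (∫ s in (0:ℝ)..t, (t - s) * stripSource U w' w'' κ s) / κ ^ 2 := by
        rw [← intervalIntegral.integral_div]
        congr 1
        ext s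
        ring
      rw [h5] at h4
      simp only [Φ, h4]
      field_simp
      ring
    rw [h3 t, h3 1]
    ring
  have hΦ1 : ∀ t, Φ 1 t = t * Φ 1 1 := by
    intro t
    have hev : (fun κ => Φ κ t) =ᶠ[nhdsWithin 1 (Set.Iio 1)] fun κ => t * Φ κ 1 := by
      filter_upwards [Ioo_mem_nhdsLT (show (0:ℝ) < 1 by norm_num)] with κ hκ using hΦ κ hκ t
    exact tendsto_nhds_unique (((hΦc t).tendsto 1).mono_left nhdsWithin_le_nhds)
      (((((hΦc 1).const_mul t).tendsto 1).mono_left nhdsWithin_le_nhds).congr' hev.symm)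
  have hF1 : Continuous fun t => stripSource U w' w'' 1 t :=
    hF.comp (by fun_prop : Continuous fun t : ℝ => ((1:ℝ), t))
  have hprim : ∀ t, HasDerivAt (fun t => ∫ s in (0:ℝ)..t, stripSource U w' w'' 1 s)
      (stripSource U w' w'' 1 t) t := fun t =>
    intervalIntegral.integral_hasDerivAt_right (hF1.intervalIntegrable _ _)
      (hF1.stronglyMeasurableAtFilter _ _) hF1.continuousAt
  have hprim2 : ∀ t, HasDerivAt (fun t => ∫ s in (0:ℝ)..t, s * stripSource U w' w'' 1 s)
      (t * stripSource U w' w'' 1 t) t := fun t =>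
    have hc : Continuous fun s => s * stripSource U w' w'' 1 s := by fun_prop
    intervalIntegral.integral_hasDerivAt_right (hc.intervalIntegrable _ _)
      (hc.stronglyMeasurableAtFilter _ _) hc.continuousAt
  refine ⟨fun t => Φ 1 1 + ∫ s in (0:ℝ)..t, stripSource U w' w'' 1 s, fun t => ⟨?_, ?_⟩⟩
  · have hrep : stripMean U w 1 = fun t => stripMean U w 1 0 + t * Φ 1 1 +
        (t * (∫ s in (0:ℝ)..t, stripSource U w' w'' 1 s) -
          ∫ s in (0:ℝ)..t, s * stripSource U w' w'' 1 s) := by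
      ext t
      have h3 := hΦ1 t
      have h4 : ∫ s in (0:ℝ)..t, (t - s) * stripSource U w' w'' 1 s =
          t * (∫ s in (0:ℝ)..t, stripSource U w' w'' 1 s) -
          ∫ s in (0:ℝ)..t, s * stripSource U w' w'' 1 s := by
        rw [← intervalIntegral.integral_const_mul, ← intervalIntegral.integral_sub]
        · congr 1
          ext s
          ring
        all_goals exact Continuous.intervalIntegrable (by fun_prop) _ _
      change 1 ^ 2 * (stripMean U w 1 t - stripMean U w 1 0) -
        ∫ s in (0:ℝ)..t, (t - s) * stripSource U w' w'' 1 s = _ at h3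
      rw [h4] at h3
      linarith
    rw [hrep]
    have h5 := (((hasDerivAt_id t).mul_const (Φ 1 1)).const_add (stripMean U w 1 0)).add
      (((hasDerivAt_id t).mul (hprim t)).sub (hprim2 t))
    exact h5.congr_deriv (by simp only [id_eq]; ring)
  · exact (hprim t).const_add _

/-- A solution of `G'' ≤ β² G` grows at most like `exp (β t)`. -/
theorem exists_le_exp_of_deriv_two_le {G G' G'' : ℝ → ℝ} (h1 : ∀ t, HasDerivAt G (G' t) t)
    (h2 : ∀ t, HasDerivAt G' (G'' t) t) {β : ℝ} (hβ : 0 < β) (h : ∀ t, G'' t ≤ β ^ 2 * G t)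
    (a : ℝ) : ∃ C, ∀ t, a ≤ t → G t ≤ C * exp (β * t) := by
  have hE : ∀ k t : ℝ, HasDerivAt (fun t => exp (k * t)) (exp (k * t) * k) t := by
    intro k t
    simpa using ((hasDerivAt_id t).const_mul k).exp
  have hP : Antitone fun t => exp (β * t) * (G' t - β * G t) := by
    refine antitone_of_hasDerivAt_nonpos
      (fun t => (hE β t).mul ((h2 t).sub ((h1 t).const_mul β))) fun t => ?_
    simp only [Pi.zero_apply]
    nlinarith [h t, exp_pos (β * t)]
  set p := |exp (β * a) * (G' a - β * G a)| with hp
  let Q : ℝ → ℝ := fun t => exp (-β * t) * G t + p / (2 * β) * exp (-(2 * β) * t)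
  have hQd : ∀ t, HasDerivAt Q (exp (-β * t) * -β * G t + exp (-β * t) * G' t +
      p / (2 * β) * (exp (-(2 * β) * t) * -(2 * β))) t := fun t =>
    ((hE (-β) t).mul (h1 t)).add ((hE (-(2 * β)) t).const_mul _)
  have hQ : AntitoneOn Q (Set.Ici a) := by
    refine antitoneOn_of_hasDerivWithinAt_nonpos (convex_Ici a)
      (fun t _ => (hQd t).continuousAt.continuousWithinAt)
      (fun t _ => (hQd t).hasDerivWithinAt) fun t ht => ?_
    rw [interior_Ici] at ht
    have h3 : exp (β * t) * (G' t - β * G t) ≤ p := (hP (le_of_lt ht)).trans (le_abs_self _)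
    have h4 : exp (-(2 * β) * t) = exp (-β * t) * exp (-β * t) := by
      rw [← exp_add]
      ring_nf
    have h5 : exp (-β * t) * exp (β * t) = 1 := by
      rw [← exp_add]
      simp
    have h6 : G' t - β * G t ≤ exp (-β * t) * p := by
      calc G' t - β * G t = exp (-β * t) * (exp (β * t) * (G' t - β * G t)) := by
            rw [← mul_assoc, h5, one_mul]
        _ ≤ _ := mul_le_mul_of_nonneg_left h3 (exp_pos _).le
    have h7 : p / (2 * β) * (exp (-(2 * β) * t) * -(2 * β)) =
        -(p * (exp (-β * t) * exp (-β * t))) := by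
      rw [h4]
      field_simp
    rw [h7]
    nlinarith [exp_pos (-β * t)]
  refine ⟨Q a, fun t ht => ?_⟩
  have h8 : exp (-β * t) * G t ≤ Q a := by
    refine le_trans ?_ (hQ Set.self_mem_Ici ht ht)
    have : 0 ≤ p / (2 * β) * exp (-(2 * β) * t) := by positivity
    linarith
  have h5 : exp (β * t) * exp (-β * t) = 1 := by
    rw [← exp_add]
    simp
  calc G t = (exp (-β * t) * G t) * exp (β * t) := by linear_combination -(G t) * h5
    _ ≤ _ := mul_le_mul_of_nonneg_right h8 (exp_pos _).le

theorem exists_integral_le_exp {G G' N : ℝ → ℝ} (h1 : ∀ t, HasDerivAt G (G' t) t)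
    (h2 : ∀ t, HasDerivAt G' (G t - N t) t) (hN : Continuous N) (hG0 : ∀ t, 0 ≤ G t)
    (hGN : ∀ t, G t ≤ 2 * N t) :
    ∃ C, ∀ t, 0 ≤ t → ∫ s in (t - 1)..(t + 1), N s ≤ C * exp (3 / 4 * t) := by
  obtain ⟨C, hC⟩ := exists_le_exp_of_deriv_two_le h1 h2 (β := 3 / 4) (by norm_num)
    (fun t => by linarith [hG0 t, hGN t]) (-2)
  have hGc : Continuous G := continuous_iff_continuousAt.2 fun t => (h1 t).continuousAt
  have hGc' : Continuous G' := continuous_iff_continuousAt.2 fun t => (h2 t).continuousAt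
  have hC0 : 0 ≤ C := by
    have := (hG0 0).trans (hC 0 (by norm_num))
    simpa using this
  refine ⟨6 * (C * exp (3 / 4 * 2)), fun t ht => ?_⟩
  set M := C * exp (3 / 4 * (t + 2)) with hM
  have hM' : 6 * (C * exp (3 / 4 * 2)) * exp (3 / 4 * t) = 6 * M := by
    rw [hM, mul_add, exp_add]
    ring
  have hGM : ∀ s, -2 ≤ s → s ≤ t + 2 → G s ≤ M := fun s hs hs' =>
    (hC s hs).trans (mul_le_mul_of_nonneg_left (exp_le_exp.2 (by linarith)) hC0)
  obtain ⟨a, ha, ha'⟩ := exists_hasDerivAt_eq_slope G G' (show t - 2 < t - 1 by linarith)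
    hGc.continuousOn fun x _ => h1 x
  obtain ⟨b, hb, hb'⟩ := exists_hasDerivAt_eq_slope G G' (show t + 1 < t + 2 by linarith)
    hGc.continuousOn fun x _ => h1 x
  have hN0 : ∀ s, 0 ≤ N s := fun s => by linarith [hG0 s, hGN s]
  have hab : a ≤ b := by linarith [ha.2, hb.1]
  have hintegral : ∫ s in (t - 1)..(t + 1), N s ≤ ∫ s in a..b, N s :=
    intervalIntegral.integral_mono_interval ha.2.le (by linarith) hb.1.le
      (Eventually.of_forall hN0) (hN.intervalIntegrable _ _)
  have h3 := intervalIntegral.integral_eq_sub_of_hasDerivAt (fun x _ => h2 x)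
    ((hGc.sub hN).intervalIntegrable a b)
  rw [intervalIntegral.integral_sub (hGc.intervalIntegrable _ _) (hN.intervalIntegrable _ _)] at h3
  have h4 : ∫ s in a..b, G s ≤ ∫ _ in a..b, M :=
    intervalIntegral.integral_mono_on hab (hGc.intervalIntegrable _ _) (by simp)
      fun s hs => hGM s (by linarith [hs.1, ha.1]) (by linarith [hs.2, hb.2])
  rw [intervalIntegral.integral_const, smul_eq_mul] at h4
  have hM0 : 0 ≤ M := by positivity
  have h5 : (b - a) * M ≤ 4 * M :=
    mul_le_mul_of_nonneg_right (by linarith [ha.1, hb.2]) hM0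
  have h6 : G' a ≤ M := by
    rw [ha', show t - 1 - (t - 2) = 1 by ring, div_one]
    linarith [hGM (t - 1) (by linarith) (by linarith), hG0 (t - 2)]
  have h7 : -G' b ≤ M := by
    rw [hb', show t + 2 - (t + 1) = 1 by ring, div_one]
    linarith [hGM (t + 1) (by linarith) (by linarith), hG0 (t + 2)]
  rw [hM']
  linarith

namespace ClassK

variable {u : ℂ → ℝ} {E : Set ℂ}

theorem nonneg (hK : ClassK u E) (z : ℂ) : 0 ≤ u z := by
  by_cases h : z ∈ E
  · exact (hK.vanish z h).ge
  · exact (hK.pos z h).le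

theorem slitPlane_subset (hK : ClassK u E) : Complex.slitPlane ⊆ Eᶜ := by
  intro z hz hE
  obtain ⟨h1, h2⟩ := hK.subNegAxis hE
  rcases hz with h | h
  · linarith
  · exact h h1

theorem harmonicAt_exp (hK : ClassK u E) {z : ℂ} (hz : |z.im| < π) :
    HarmonicAt (fun z => u (Complex.exp z)) z :=
  harmonicAt_comp_exp ((hK.harm.harmonicOnNhd hK.cont hK.closed.isOpen_compl).mono
    hK.slitPlane_subset) hz

theorem continuous_comp_exp (hK : ClassK u E) : Continuous fun z => u (Complex.exp z) :=
  hK.cont.comp Complex.continuous_exp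

theorem stripMean_nonneg (hK : ClassK u E) {w : ℝ → ℝ}
    (hw : ∀ x ∈ Set.Icc (-π) π, 0 ≤ w x) (t : ℝ) :
    0 ≤ stripMean (fun z => u (Complex.exp z)) w 1 t :=
  intervalIntegral.integral_nonneg (by linarith [pi_pos]) fun x hx =>
    mul_nonneg (hK.nonneg _) (hw x hx)

theorem exists_integral_mean_le (hK : ClassK u E) :
    ∃ C, ∀ t, 0 ≤ t → ∫ s in (t - 1)..(t + 1),
      stripMean (fun z => u (Complex.exp z)) (fun _ => 1) 1 s ≤ C * exp (3 / 4 * t) := by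
  set U : ℂ → ℝ := fun z => u (Complex.exp z) with hU
  have hUc : Continuous U := hK.continuous_comp_exp
  obtain ⟨G', hG'⟩ := stripMean_deriv (U := U) hUc (fun z hz => hK.harmonicAt_exp hz)
    (w := fun φ => 1 + cos φ) (w' := fun φ => -sin φ) (w'' := fun φ => -cos φ)
    (fun x => (hasDerivAt_cos x).const_add 1) (fun x => (hasDerivAt_sin x).neg)
    (by fun_prop) (by simp) (by simp)
  have hlin : ∀ t, stripSource U (fun φ => -sin φ) (fun φ => -cos φ) 1 t =
      stripMean U (fun φ => 1 + cos φ) 1 t - stripMean U (fun _ => 1) 1 t := by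
    intro t
    simp only [stripSource, stripMean]
    rw [← intervalIntegral.integral_sub
      (Continuous.intervalIntegrable (by fun_prop) _ _)
      (Continuous.intervalIntegrable (by fun_prop) _ _)]
    simp only [sin_neg, sin_pi, neg_zero, mul_zero, sub_zero, zero_sub,
      ← intervalIntegral.integral_neg]
    congr 1
    ext φ
    ring
  simp only [hlin] at hG'
  have hN : Continuous fun t => stripMean U (fun _ => 1) 1 t :=
    (continuous_stripMean hUc continuous_const).comp
      (by fun_prop : Continuous fun t : ℝ => ((1 : ℝ), t))
  refine exists_integral_le_exp (fun t => (hG' t).1) (fun t => (hG' t).2) hN ?_ ?_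
  · exact hK.stripMean_nonneg fun x _ => by linarith [neg_one_le_cos x]
  · intro t
    simp only [stripMean]
    rw [← intervalIntegral.integral_const_mul]
    refine intervalIntegral.integral_mono_on (by linarith [pi_pos])
      (Continuous.intervalIntegrable (by fun_prop) _ _)
      (Continuous.intervalIntegrable (by fun_prop) _ _) fun φ _ => ?_
    have h3 : 0 ≤ U (t + (1 * φ : ℝ) * Complex.I) := hK.nonneg _
    nlinarith [cos_le_one φ]

end ClassK

namespace ClassK

variable {u : ℂ → ℝ} {E : Set ℂ}

theorem apply_le_integral_mean (hK : ClassK u E) {z : ℂ} {t : ℝ} (hz : ‖z‖ = exp t) :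
    u z ≤ 12 * exp 2 / π * ∫ s in (t - 1)..(t + 1),
      stripMean (fun z => u (Complex.exp z)) (fun _ => 1) 1 s := by
  have huc := hK.cont
  set R := exp t with hR
  have hR0 : 0 < R := exp_pos t
  have he : 2 < exp 1 := by linarith [exp_one_gt_d9]
  let χ : ℝ → ℝ := fun s => max 0 (1 - 2 * s / R)
  have hχ : Continuous χ := by fun_prop
  have hχ0 : ∀ s, 0 ≤ χ s := fun s => le_max_left _ _
  have hχs : ∀ s, R / 2 ≤ s → χ s = 0 := by
    intro s hs
    apply max_eq_left
    rw [sub_nonpos, le_div_iff₀ hR0]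
    linarith
  have hχ1 : ∀ s, 0 ≤ s → χ s ≤ 1 := by
    intro s hs
    apply max_le zero_le_one
    have : 0 ≤ 2 * s / R := by positivity
    linarith
  have hmass : ∫ r in (0:ℝ)..(R / 2), r * χ r = R ^ 2 / 24 := by
    have h1 : ∫ r in (0:ℝ)..(R / 2), r * χ r = ∫ r in (0:ℝ)..(R / 2), (r - 2 / R * r ^ 2) := by
      apply intervalIntegral.integral_congr
      intro r hr
      rw [Set.uIcc_of_le (by positivity)] at hr
      have h2 : χ r = 1 - 2 * r / R := by
        apply max_eq_right
        rw [sub_nonneg, div_le_iff₀ hR0]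
        linarith [hr.2]
      simp only [h2]
      ring
    rw [h1, intervalIntegral.integral_sub (Continuous.intervalIntegrable (by fun_prop) _ _)
      (Continuous.intervalIntegrable (by fun_prop) _ _), intervalIntegral.integral_const_mul,
      integral_id, integral_pow]
    field_simp
    ring
  have hsub := le_integral_radial_mul huc hχ (by positivity) hχs hχ0 hK.submean z
  let g : ℂ → ℝ := fun ξ => χ ‖ξ - z‖ * u ξ
  have hg : Continuous g := by fun_prop
  have htr : ∫ ζ, χ ‖ζ‖ * u (z + ζ) = ∫ ξ, g ξ := by
    rw [← integral_add_left_eq_self g z]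
    simp [g]
  have hgz : ∀ ξ : ℂ, ‖ξ‖ ≤ R / 2 ∨ exp (t + 1) ≤ ‖ξ‖ → g ξ = 0 := by
    intro ξ hξ
    have : R / 2 ≤ ‖ξ - z‖ := by
      rcases hξ with h | h
      · have := norm_sub_norm_le z ξ
        rw [norm_sub_rev] at this
        linarith
      · have := norm_sub_norm_le ξ z
        rw [exp_add] at h
        nlinarith
    simp only [g, hχs _ this, zero_mul]
  have hnorm : ∀ r θ : ℝ, 0 ≤ r → ‖(r : ℂ) * Complex.exp (θ * Complex.I)‖ = r := by
    intro r θ hr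
    rw [norm_mul, Complex.norm_exp_ofReal_mul_I, mul_one, Complex.norm_real, norm_of_nonneg hr]
  rw [htr, integral_eq_polar hg (exp_pos (t + 1)).le (fun ξ hξ => hgz ξ (Or.inr hξ)), hmass] at hsub
  set I : ℝ → ℝ := fun r => r * ∫ θ in (-π)..π, g (r * Complex.exp (θ * Complex.I)) with hI
  have hIc : Continuous I := continuous_id.mul
    (intervalIntegral.continuous_parametric_intervalIntegral_of_continuous' (by fun_prop) _ _)
  have hsplit : ∫ r in (0:ℝ)..exp (t + 1), I r = ∫ r in exp (t - 1)..exp (t + 1), I r := by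
    rw [← intervalIntegral.integral_add_adjacent_intervals (b := exp (t - 1))
      (hIc.intervalIntegrable _ _) (hIc.intervalIntegrable _ _), add_eq_right]
    refine intervalIntegral.integral_zero_ae (Eventually.of_forall fun r hr => ?_)
    rw [Set.uIoc_of_le (exp_pos _).le] at hr
    have h1 : r ≤ R / 2 := by
      refine hr.2.trans ?_
      rw [exp_sub]
      exact div_le_div_of_nonneg_left hR0.le (by norm_num) he.le
    have h2 : ∀ θ : ℝ, g (r * Complex.exp (θ * Complex.I)) = 0 := fun θ =>
      hgz _ (Or.inl ((hnorm r θ hr.1.le).trans_le h1))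
    simp [hI, h2]
  have hsubst := intervalIntegral.integral_comp_mul_deriv (a := t - 1) (b := t + 1)
    (f := exp) (f' := exp) (g := I) (fun x _ => hasDerivAt_exp x) continuous_exp.continuousOn hIc
  set N : ℝ → ℝ := fun s => stripMean (fun z => u (Complex.exp z)) (fun _ => 1) 1 s with hNdef
  have hNc : Continuous N :=
    (continuous_stripMean hK.continuous_comp_exp continuous_const).comp
      (by fun_prop : Continuous fun t : ℝ => ((1 : ℝ), t))
  have hIN : ∀ s, I (exp s) ≤ exp s * N s := by
    intro s
    refine mul_le_mul_of_nonneg_left ?_ (exp_pos s).le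
    refine intervalIntegral.integral_mono_on (by linarith [pi_pos])
      (Continuous.intervalIntegrable (by fun_prop) _ _)
      (Continuous.intervalIntegrable (by fun_prop) _ _) fun θ _ => ?_
    have : Complex.exp (s + (1 * θ : ℝ) * Complex.I) =
        (exp s : ℝ) * Complex.exp (θ * Complex.I) := by
      rw [Complex.exp_add, Complex.ofReal_exp, one_mul]
    simp only [this, mul_one, g]
    exact mul_le_of_le_one_left (hK.nonneg _) (hχ1 _ (norm_nonneg _))
  have hN0 : ∀ s, 0 ≤ N s := hK.stripMean_nonneg fun _ _ => zero_le_one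
  have hfin : ∫ s in (t - 1)..(t + 1), (I ∘ exp) s * exp s ≤
      ∫ s in (t - 1)..(t + 1), exp (t + 1) ^ 2 * N s := by
    refine intervalIntegral.integral_mono_on (by linarith)
      (Continuous.intervalIntegrable (by fun_prop) _ _)
      (Continuous.intervalIntegrable (by fun_prop) _ _) fun s hs => ?_
    have h1 : exp s ≤ exp (t + 1) := exp_le_exp.2 hs.2
    calc (I ∘ exp) s * exp s ≤ (exp s * N s) * exp s :=
          mul_le_mul_of_nonneg_right (hIN s) (exp_pos s).le
      _ = exp s ^ 2 * N s := by ring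
      _ ≤ _ := mul_le_mul_of_nonneg_right (pow_le_pow_left₀ (exp_pos s).le h1 2) (hN0 s)
  rw [intervalIntegral.integral_const_mul] at hfin
  rw [hsplit, ← hsubst] at hsub
  have h2 := hsub.trans hfin
  have h3 : exp (t + 1) ^ 2 = exp 2 * R ^ 2 := by
    rw [hR, ← exp_nat_mul, ← exp_nat_mul, ← exp_add]
    congr 1
    push_cast
    ring
  rw [h3] at h2
  have h4 : u z * (π / 12) ≤ exp 2 * ∫ s in (t - 1)..(t + 1), N s := by
    have : 0 < R ^ 2 := by positivity
    refine le_of_mul_le_mul_right ?_ this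
    linarith
  rw [div_mul_eq_mul_div, le_div_iff₀ pi_pos]
  linarith

/-- Functions of class `𝒦` have order at most `3/4`. -/
theorem exists_growth (hK : ClassK u E) :
    ∃ C, 0 < C ∧ ∀ z : ℂ, 1 ≤ ‖z‖ → u z ≤ C * ‖z‖ ^ (3 / 4 : ℝ) := by
  obtain ⟨C, hC⟩ := hK.exists_integral_mean_le
  refine ⟨12 * exp 2 / π * |C| + 1, by positivity, fun z hz => ?_⟩
  have hz0 : 0 < ‖z‖ := by linarith
  have h1 := hK.apply_le_integral_mean (exp_log hz0).symm
  have h2 := hC _ (log_nonneg hz)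
  have h3 : exp (3 / 4 * log ‖z‖) = ‖z‖ ^ (3 / 4 : ℝ) := by
    rw [rpow_def_of_pos hz0, mul_comm]
  rw [h3] at h2
  have h4 : 0 < ‖z‖ ^ (3 / 4 : ℝ) := rpow_pos_of_pos hz0 _
  have h5 : 0 ≤ 12 * exp 2 / π := by positivity
  calc u z ≤ _ := h1
    _ ≤ 12 * exp 2 / π * (C * ‖z‖ ^ (3 / 4 : ℝ)) := mul_le_mul_of_nonneg_left h2 h5
    _ ≤ 12 * exp 2 / π * (|C| * ‖z‖ ^ (3 / 4 : ℝ)) := by gcongr; exact le_abs_self C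
    _ ≤ _ := by nlinarith

end ClassK

/-- A harmonic majorant for functions of order less than `7/8` in the upper half-plane. -/
noncomputable def halfPlaneBarrier (z : ℂ) : ℝ :=
  ((1 - Complex.I * z) ^ ((7 / 8 : ℝ) : ℂ)).re

theorem analyticAt_halfPlaneBarrier {z : ℂ} (hz : 0 ≤ z.im) :
    AnalyticAt ℂ (fun z => (1 - Complex.I * z) ^ ((7 / 8 : ℝ) : ℂ)) z := by
  refine AnalyticAt.cpow (by fun_prop) (by fun_prop) (Or.inl ?_)
  simp
  linarith

theorem halfPlaneBarrier_mean {z : ℂ} {ρ : ℝ} (hρ : 0 < ρ) (hz : ρ < z.im) :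
    halfPlaneBarrier z = (1 / (2 * π)) *
      ∫ θ in (0:ℝ)..(2 * π), halfPlaneBarrier (z + ρ * Complex.exp (θ * Complex.I)) := by
  have h : HarmonicOnNhd halfPlaneBarrier (closedBall z |ρ|) := by
    intro x hx
    refine AnalyticAt.harmonicAt_re (f := fun z => (1 - Complex.I * z) ^ ((7 / 8 : ℝ) : ℂ))
      (analyticAt_halfPlaneBarrier ?_)
    rw [abs_of_pos hρ, mem_closedBall, dist_eq_norm] at hx
    have h1 := (Complex.abs_im_le_norm (x - z)).trans hx
    rw [Complex.sub_im] at h1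
    linarith [neg_le_of_abs_le h1]
  rw [← h.circleAverage_eq, circleAverage_def, one_div]
  rfl

theorem continuousOn_halfPlaneBarrier : ContinuousOn halfPlaneBarrier {z | 0 ≤ z.im} :=
  fun _ hz => (Complex.continuous_re.continuousAt.comp
    (analyticAt_halfPlaneBarrier hz).continuousAt).continuousWithinAt

theorem cos_mul_rpow_le_halfPlaneBarrier {z : ℂ} (hz : 0 ≤ z.im) :
    cos (π / 2 * (7 / 8)) * ‖z‖ ^ (7 / 8 : ℝ) ≤ halfPlaneBarrier z := by
  rw [halfPlaneBarrier, Complex.cpow_ofReal_re, mul_comm]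
  have hre : 0 ≤ (1 - Complex.I * z).re := by
    simp
    linarith
  have harg := Complex.abs_arg_le_pi_div_two_iff.2 hre
  have hn : ‖z‖ ≤ ‖1 - Complex.I * z‖ := by
    rw [Complex.norm_def, Complex.norm_def]
    apply sqrt_le_sqrt
    simp only [Complex.normSq_apply]
    simp
    nlinarith
  have hcos : cos (π / 2 * (7 / 8)) ≤ cos (Complex.arg (1 - Complex.I * z) * (7 / 8)) := by
    rw [← cos_abs (Complex.arg (1 - Complex.I * z) * (7 / 8)), abs_mul]
    apply cos_le_cos_of_nonneg_of_le_pi (by positivity) (by linarith [pi_pos])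
    rw [abs_of_pos (show (0:ℝ) < 7 / 8 by norm_num)]
    linarith
  have hc0 : 0 ≤ cos (π / 2 * (7 / 8)) :=
    cos_nonneg_of_neg_pi_div_two_le_of_le (by linarith [pi_pos]) (by linarith [pi_pos])
  exact mul_le_mul (rpow_le_rpow (norm_nonneg _) hn (by norm_num)) hcos hc0 (by positivity)

/-- Phragmén–Lindelöf principle in the upper half-plane for functions of order at most `3/4` with
a local sub-mean-value property. -/
theorem nonpos_of_submean_halfPlane {s : ℂ → ℝ} (hs : Continuous s)
    (h0 : ∀ z : ℂ, z.im = 0 → s z = 0)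
    (hm : ∀ (z : ℂ) (ρ : ℝ), 0 < ρ → ρ < z.im → s z ≤
      (1 / (2 * π)) * ∫ θ in (0:ℝ)..(2 * π), s (z + ρ * Complex.exp (θ * Complex.I)))
    {C : ℝ} (hC : ∀ z : ℂ, 1 ≤ ‖z‖ → s z ≤ C * ‖z‖ ^ (3 / 4 : ℝ)) {z : ℂ} (hz : 0 ≤ z.im) :
    s z ≤ 0 := by
  set b := halfPlaneBarrier with hb
  set c := cos (π / 2 * (7 / 8)) with hc
  have hc0 : 0 < c := cos_pos_of_mem_Ioo ⟨by linarith [pi_pos], by linarith [pi_pos]⟩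
  have hb0 : ∀ x : ℂ, 0 ≤ x.im → 0 ≤ b x := fun x hx =>
    le_trans (by positivity) (cos_mul_rpow_le_halfPlaneBarrier hx)
  suffices H : ∀ ε, 0 < ε → s z - ε * b z ≤ 0 by
    by_contra! hpos
    have h1 := H (s z / (2 * (b z + 1))) (by have := hb0 z hz; positivity)
    have h2 : s z / (2 * (b z + 1)) * b z ≤ s z / 2 := by
      have := hb0 z hz
      rw [div_mul_eq_mul_div, div_le_div_iff₀ (by positivity) (by norm_num)]
      nlinarith
    linarith
  intro ε hε
  by_contra! hpos
  obtain ⟨R, hRz, hR1, hRC⟩ : ∃ R : ℝ, ‖z‖ ≤ R ∧ 1 ≤ R ∧ C / (ε * c) < R ^ (1 / 8 : ℝ) :=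
    ((eventually_ge_atTop ‖z‖).and ((eventually_ge_atTop 1).and
      ((tendsto_rpow_atTop (by norm_num : (0:ℝ) < 1 / 8)).eventually_gt_atTop _))).exists
  have hbd : ∀ x : ℂ, 0 ≤ x.im → ‖x‖ = R → s x - ε * b x ≤ 0 := by
    intro x hx hxR
    have h1 := hC x (hxR ▸ hR1)
    have h2 := cos_mul_rpow_le_halfPlaneBarrier hx
    rw [hxR] at h1 h2
    have h3 : R ^ (7 / 8 : ℝ) = R ^ (1 / 8 : ℝ) * R ^ (3 / 4 : ℝ) := by
      rw [← rpow_add (by linarith)]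
      norm_num
    rw [div_lt_iff₀ (by positivity)] at hRC
    have h4 : 0 < R ^ (3 / 4 : ℝ) := rpow_pos_of_pos (by linarith) _
    have h5 : C * R ^ (3 / 4 : ℝ) ≤ ε * (c * R ^ (7 / 8 : ℝ)) := by
      rw [h3]
      nlinarith
    have h6 := mul_le_mul_of_nonneg_left h2 hε.le
    linarith
  let h : ℂ → ℝ := fun x => s x - ε * b x
  have hcl : IsClosed {x : ℂ | 0 ≤ x.im} := isClosed_le continuous_const Complex.continuous_im
  have hhc : ContinuousOn h {x | 0 ≤ x.im} :=
    hs.continuousOn.sub (continuousOn_const.mul continuousOn_halfPlaneBarrier)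
  set K : Set ℂ := closedBall 0 R ∩ {x | 0 ≤ x.im} with hKdef
  have hK : IsCompact K := (isCompact_closedBall _ _).inter_right hcl
  have hhK : ContinuousOn h K := hhc.mono Set.inter_subset_right
  have hzK : z ∈ K := ⟨by simpa using hRz, hz⟩
  obtain ⟨x₀, hx₀, hmax⟩ := hK.exists_isMaxOn ⟨z, hzK⟩ hhK
  have hM : 0 < h x₀ := lt_of_lt_of_le hpos (hmax hzK)
  have hL : IsCompact (K ∩ h ⁻¹' {h x₀}) :=
    hK.of_isClosed_subset (hhK.preimage_isClosed_of_isClosed hK.isClosed isClosed_singleton)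
      Set.inter_subset_left
  obtain ⟨x, ⟨hxK, hxM⟩, hxtop⟩ :=
    hL.exists_isMaxOn ⟨x₀, hx₀, rfl⟩ Complex.continuous_im.continuousOn
  replace hxM : h x = h x₀ := hxM
  have hxim : 0 < x.im := by
    refine lt_of_le_of_ne hxK.2 fun h1 => ?_
    have h2 : h x ≤ 0 := by
      have := mul_nonneg hε.le (hb0 x hxK.2)
      simp only [h, h0 x h1.symm]
      linarith
    linarith
  have hxR : ‖x‖ < R := by
    refine lt_of_le_of_ne (by simpa using hxK.1) fun h1 => ?_
    have h2 : h x ≤ 0 := hbd x hxK.2 h1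
    linarith
  obtain ⟨ρ, hρ, hρ'⟩ := exists_between (lt_min hxim (sub_pos.2 hxR))
  have hρim : ρ < x.im := hρ'.trans_le (min_le_left _ _)
  have hcirc : ∀ θ : ℝ, x + ρ * Complex.exp (θ * Complex.I) ∈ K := by
    intro θ
    have hn : ‖(ρ : ℂ) * Complex.exp (θ * Complex.I)‖ = ρ := by
      rw [norm_mul, Complex.norm_exp_ofReal_mul_I, mul_one, Complex.norm_real, norm_of_nonneg hρ.le]
    constructor
    · rw [mem_closedBall_zero_iff]
      have := norm_add_le x ((ρ : ℂ) * Complex.exp (θ * Complex.I))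
      linarith [hρ'.trans_le (min_le_right _ _)]
    · have := neg_le_of_abs_le (Complex.abs_im_le_norm ((ρ : ℂ) * Complex.exp (θ * Complex.I)))
      rw [hn] at this
      change 0 ≤ (x + (ρ : ℂ) * Complex.exp (θ * Complex.I)).im
      rw [Complex.add_im]
      linarith
  have hcc : Continuous fun θ : ℝ => x + ρ * Complex.exp (θ * Complex.I) := by fun_prop
  have hhcirc : Continuous fun θ : ℝ => h (x + ρ * Complex.exp (θ * Complex.I)) :=
    hhK.comp_continuous hcc hcirc
  have hbcirc : Continuous fun θ : ℝ => b (x + ρ * Complex.exp (θ * Complex.I)) :=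
    continuousOn_halfPlaneBarrier.comp_continuous hcc fun θ => (hcirc θ).2
  have hmean : h x ≤ (1 / (2 * π)) *
      ∫ θ in (0:ℝ)..(2 * π), h (x + ρ * Complex.exp (θ * Complex.I)) := by
    simp only [h]
    rw [intervalIntegral.integral_sub (Continuous.intervalIntegrable (by fun_prop) _ _)
      ((hbcirc.const_mul ε).intervalIntegrable _ _), intervalIntegral.integral_const_mul]
    have h1 := hm x ρ hρ hρim
    have h2 := halfPlaneBarrier_mean hρ hρim
    rw [← hb] at h2
    rw [mul_sub, mul_left_comm, ← h2]
    linarith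
  have hlt : ∫ θ in (0:ℝ)..(2 * π), h (x + ρ * Complex.exp (θ * Complex.I)) <
      ∫ _ in (0:ℝ)..(2 * π), h x := by
    refine intervalIntegral.integral_lt_integral_of_continuousOn_of_le_of_exists_lt two_pi_pos
      hhcirc.continuousOn continuousOn_const (fun θ _ => hxM ▸ hmax (hcirc θ))
      ⟨π / 2, ⟨by positivity, by linarith [pi_pos]⟩, ?_⟩
    refine lt_of_le_of_ne (hxM ▸ hmax (hcirc _)) fun h1 => ?_
    have h2 : (x + ρ * Complex.exp ((π / 2 : ℝ) * Complex.I)).im ≤ x.im :=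
      hxtop ⟨hcirc _, h1.trans hxM⟩
    have h3 : Complex.exp ((π / 2 : ℝ) * Complex.I) = Complex.I := by
      push_cast
      exact Complex.exp_pi_div_two_mul_I
    rw [h3] at h2
    simp at h2
    linarith
  rw [intervalIntegral.integral_const, smul_eq_mul, sub_zero] at hlt
  rw [one_div, le_inv_mul_iff₀ two_pi_pos] at hmean
  linarith

namespace ClassK

variable {u : ℂ → ℝ} {E : Set ℂ}

theorem reflected_closedBall_subset (hK : ClassK u E) {φ : ℝ} (hφ : φ ∈ Set.Ioo 0 π)
    {ζ : ℂ} {ρ : ℝ} (hρ : ρ < ζ.im) :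
    closedBall (Complex.exp (φ * Complex.I) * (starRingEnd ℂ) ζ) ρ ⊆ Eᶜ := by
  intro p hp hpE
  obtain ⟨h1, h2⟩ := hK.subNegAxis hpE
  have he : Complex.exp (-φ * Complex.I) * Complex.exp (φ * Complex.I) = 1 := by
    rw [← Complex.exp_add]
    simp
  have hne : ‖Complex.exp (-φ * Complex.I)‖ = 1 := by
    simpa using Complex.norm_exp_ofReal_mul_I (-φ)
  rw [mem_closedBall, dist_eq_norm] at hp
  have h3 : ‖Complex.exp (-φ * Complex.I) * p - (starRingEnd ℂ) ζ‖ ≤ ρ := by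
    calc ‖Complex.exp (-φ * Complex.I) * p - (starRingEnd ℂ) ζ‖
        = ‖Complex.exp (-φ * Complex.I) * (p - Complex.exp (φ * Complex.I) * (starRingEnd ℂ) ζ)‖ := by
          rw [mul_sub, ← mul_assoc, he, one_mul]
      _ ≤ ρ := by rwa [norm_mul, hne, one_mul]
  have h4 := le_of_abs_le ((Complex.abs_im_le_norm _).trans h3)
  have h5 : (Complex.exp (-φ * Complex.I) * p).im = -(p.re * sin φ) := by
    have hexp : Complex.exp (-φ * Complex.I) = cos φ - sin φ * Complex.I := by
      rw [Complex.exp_mul_I, Complex.cos_neg, Complex.sin_neg, Complex.ofReal_cos,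
        Complex.ofReal_sin]
      ring
    rw [hexp, Complex.mul_im, h1]
    simp [Complex.cos_ofReal_re, Complex.sin_ofReal_re]
    ring
  rw [Complex.sub_im, Complex.conj_im, h5] at h4
  have := sin_pos_of_mem_Ioo hφ
  nlinarith

/-- On each circle centred at the origin, `u` attains its minimum on the negative axis. -/
theorem apply_neg_le (hK : ClassK u E) {r θ : ℝ} (hr : 0 ≤ r) (hθ : θ ∈ Set.Ioo (-π) π) :
    u (-r) ≤ u (r * Complex.exp (θ * Complex.I)) := by
  have huc := hK.cont
  set φ := (θ + π) / 2 with hφdef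
  have hφ : φ ∈ Set.Ioo 0 π := ⟨by linarith [hθ.1], by linarith [hθ.2]⟩
  set e := Complex.exp (φ * Complex.I) with he
  have hne : ‖e‖ = 1 := Complex.norm_exp_ofReal_mul_I φ
  let s : ℂ → ℝ := fun ζ => u (e * ζ) - u (e * (starRingEnd ℂ) ζ)
  have hconj : Continuous (starRingEnd ℂ) := Complex.continuous_conj
  have hs : Continuous s := by fun_prop
  obtain ⟨C, hC0, hC⟩ := hK.exists_growth
  have hmain : ∀ ζ : ℂ, 0 ≤ ζ.im → s ζ ≤ 0 := by
    intro ζ hζ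
    refine nonpos_of_submean_halfPlane hs ?_ ?_ (C := C) ?_ hζ
    · intro z hz
      simp only [s, Complex.conj_eq_iff_im.2 hz, sub_self]
    · intro z ρ hρ hρz
      have h1 := hK.submean (e * z) ρ hρ
      have hball := hK.reflected_closedBall_subset hφ hρz
      have h2 := hK.harm _ (hball (mem_closedBall_self hρ.le)) ρ hρ hball
      rw [← he] at h2
      have h3 : ∫ θ in (0:ℝ)..(2 * π), u (e * (z + ρ * Complex.exp (θ * Complex.I))) =
          ∫ θ in (0:ℝ)..(2 * π), u (e * z + ρ * Complex.exp (θ * Complex.I)) := by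
        have h4 := intervalIntegral.integral_comp_add_right (a := 0) (b := 2 * π)
          (fun θ : ℝ => u (e * z + ρ * Complex.exp (θ * Complex.I))) φ
        rw [zero_add, add_comm (2 * π) φ, integral_circle_shift] at h4
        rw [← h4]
        congr 1
        ext θ
        congr 1
        push_cast
        rw [add_mul, Complex.exp_add, ← he]
        ring
      have h5 : ∫ θ in (0:ℝ)..(2 * π),
            u (e * (starRingEnd ℂ) (z + ρ * Complex.exp (θ * Complex.I))) =
          ∫ θ in (0:ℝ)..(2 * π),
            u (e * (starRingEnd ℂ) z + ρ * Complex.exp (θ * Complex.I)) := by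
        have h4 := intervalIntegral.integral_comp_sub_left (a := 0) (b := 2 * π)
          (fun θ : ℝ => u (e * (starRingEnd ℂ) z + ρ * Complex.exp (θ * Complex.I))) φ
        rw [sub_zero] at h4
        have h6 := integral_circle_shift (v := u) (e * (starRingEnd ℂ) z) ρ (φ - 2 * π)
        rw [sub_add_cancel] at h6
        rw [h6] at h4
        rw [← h4]
        congr 1
        ext θ
        congr 1
        rw [map_add, map_mul, Complex.conj_ofReal, ← Complex.exp_conj, map_mul,
          Complex.conj_ofReal, Complex.conj_I]
        push_cast
        rw [sub_mul, sub_eq_add_neg, Complex.exp_add, ← he, mul_neg]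
        ring
      simp only [s]
      rw [intervalIntegral.integral_sub (Continuous.intervalIntegrable (by fun_prop) _ _)
        (Continuous.intervalIntegrable (by fun_prop) _ _), h3, h5, mul_sub, ← h2]
      linarith
    · intro z hz
      have h1 := hC (e * z) (by rwa [norm_mul, hne, one_mul])
      rw [norm_mul, hne, one_mul] at h1
      have := hK.nonneg (e * (starRingEnd ℂ) z)
      simp only [s]
      linarith
  have h1 := hmain (r * Complex.exp ((π - φ : ℝ) * Complex.I)) (by
    rw [Complex.im_ofReal_mul, Complex.exp_ofReal_mul_I_im]
    exact mul_nonneg hr (sin_nonneg_of_mem_Icc ⟨by linarith [hφ.2], by linarith [hφ.1]⟩))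
  have h2 : e * (r * Complex.exp ((π - φ : ℝ) * Complex.I)) = -r := by
    rw [mul_left_comm, he, ← Complex.exp_add, ← add_mul, ← Complex.ofReal_add,
      add_sub_cancel, Complex.exp_pi_mul_I]
    ring
  have h3 : e * (starRingEnd ℂ) (r * Complex.exp ((π - φ : ℝ) * Complex.I)) =
      r * Complex.exp (θ * Complex.I) := by
    rw [map_mul, Complex.conj_ofReal, ← Complex.exp_conj, map_mul,
      Complex.conj_ofReal, Complex.conj_I, mul_left_comm, he, ← Complex.exp_add]
    congr 2
    rw [hφdef]
    push_cast
    ring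
  simp only [s, h2, h3] at h1
  linarith

end ClassK

theorem integral_cos_half : ∫ φ in (-π)..π, cos (φ / 2) = 4 := by
  rw [intervalIntegral.integral_comp_div (fun x => cos x) two_ne_zero, integral_cos, neg_div,
    sin_neg, sin_pi_div_two]
  norm_num

theorem cos_half_nonneg {φ : ℝ} (hφ : φ ∈ Set.Icc (-π) π) : 0 ≤ cos (φ / 2) :=
  cos_nonneg_of_mem_Icc ⟨by linarith [hφ.1], by linarith [hφ.2]⟩

theorem le_Bmax {u : ℂ → ℝ} (hu : Continuous u) {r : ℝ} {z : ℂ} (hz : ‖z‖ = r) : u z ≤ Bmax u r :=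
  le_csSup ((isCompact_sphere 0 r).image hu).bddAbove ⟨z, by simpa using hz, rfl⟩

/-- A nondecreasing derivative of a function bounded above near `-∞` is nonnegative. -/
theorem deriv_nonneg_of_monotone_of_bddAbove {J J' : ℝ → ℝ} (h1 : ∀ t, HasDerivAt J (J' t) t)
    (h2 : Monotone J') {M : ℝ} (hM : ∀ t ≤ 0, J t ≤ M) (t : ℝ) : 0 ≤ J' t := by
  by_contra! hneg
  have hle : ∀ x ≤ t, J t + J' t * (x - t) ≤ J x := by
    have hanti : AntitoneOn (fun x => J x - J' t * x) (Set.Iic t) := by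
      refine antitoneOn_of_hasDerivWithinAt_nonpos (convex_Iic t) (f' := fun x => J' x - J' t)
        (fun x _ => ((h1 x).continuousAt.sub (by fun_prop)).continuousWithinAt)
        (fun x _ => ?_) fun x hx => ?_
      · exact (((h1 x).sub ((hasDerivAt_id x).const_mul (J' t))).congr_deriv
          (by rw [mul_one])).hasDerivWithinAt
      · rw [interior_Iic] at hx
        exact sub_nonpos.2 (h2 (le_of_lt hx))
    intro x hx
    have := hanti (Set.mem_Iic.2 hx) Set.self_mem_Iic hx
    simp only at this
    linarith
  set y := t + (M + 1 - J t) / J' t with hy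
  have hy' : J' t * (y - t) = M + 1 - J t := by
    rw [hy, add_sub_cancel_left, mul_div_cancel₀ _ hneg.ne]
  set x := min (min t 0) y with hx
  have hxt : x ≤ t := (min_le_left _ _).trans (min_le_left _ _)
  have hx0 : x ≤ 0 := (min_le_left _ _).trans (min_le_right _ _)
  have hxy : x ≤ y := min_le_right _ _
  have := hle x hxt
  have := hM x hx0
  nlinarith

theorem cexp_add_one_mul_I (t φ : ℝ) : Complex.exp (t + (1 * φ : ℝ) * Complex.I) =
    (exp t : ℝ) * Complex.exp (φ * Complex.I) := by
  rw [Complex.exp_add, Complex.ofReal_exp, one_mul]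

/-- The weighted angular mean of `u` over the circle of radius `exp t`. -/
noncomputable def cosMean (u : ℂ → ℝ) (t : ℝ) : ℝ :=
  stripMean (fun z => u (Complex.exp z)) (fun φ => cos (φ / 2)) 1 t

namespace ClassK

variable {u : ℂ → ℝ} {E : Set ℂ}

theorem apply_neg_le_strip (hK : ClassK u E) (t : ℝ) {φ : ℝ} (hφ : φ ∈ Set.Icc (-π) π) :
    u (-(exp t : ℝ)) ≤ u (Complex.exp (t + (1 * φ : ℝ) * Complex.I)) := by
  rw [cexp_add_one_mul_I]
  rcases eq_or_lt_of_le hφ.1 with h | h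
  · rw [← h]
    push_cast
    rw [neg_mul, Complex.exp_neg, Complex.exp_pi_mul_I]
    norm_num
  rcases eq_or_lt_of_le hφ.2 with h' | h'
  · rw [h', Complex.exp_pi_mul_I]
    norm_num
  exact hK.apply_neg_le (exp_pos t).le ⟨h, h'⟩

theorem cosMean_le (hK : ClassK u E) {t M : ℝ} (hM : ∀ z, ‖z‖ = exp t → u z ≤ M) :
    cosMean u t ≤ 4 * M := by
  have huc := hK.cont
  rw [← integral_cos_half, ← intervalIntegral.integral_mul_const]
  refine intervalIntegral.integral_mono_on (by linarith [pi_pos])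
    (Continuous.intervalIntegrable (by fun_prop) _ _)
    (Continuous.intervalIntegrable (by fun_prop) _ _) fun φ hφ => ?_
  rw [mul_comm]
  refine mul_le_mul_of_nonneg_left (hM _ ?_) (cos_half_nonneg hφ)
  rw [cexp_add_one_mul_I, norm_mul, Complex.norm_exp_ofReal_mul_I, mul_one, Complex.norm_real,
    norm_of_nonneg (exp_pos t).le]

theorem le_cosMean (hK : ClassK u E) (t : ℝ) : 4 * u (-(exp t : ℝ)) ≤ cosMean u t := by
  have huc := hK.cont
  rw [← integral_cos_half, ← intervalIntegral.integral_mul_const]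
  refine intervalIntegral.integral_mono_on (by linarith [pi_pos])
    (Continuous.intervalIntegrable (by fun_prop) _ _)
    (Continuous.intervalIntegrable (by fun_prop) _ _) fun φ hφ => ?_
  rw [mul_comm]
  exact mul_le_mul_of_nonneg_right (hK.apply_neg_le_strip t hφ) (cos_half_nonneg hφ)

theorem cosMean_pos (hK : ClassK u E) (t : ℝ) : 0 < cosMean u t := by
  have huc := hK.cont
  refine intervalIntegral.intervalIntegral_pos_of_pos_on
    (Continuous.intervalIntegrable (by fun_prop) _ _) (fun φ hφ => ?_) (by linarith [pi_pos])
  refine mul_pos (hK.pos _ (hK.slitPlane_subset ?_))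
    (cos_pos_of_mem_Ioo ⟨by linarith [hφ.1], by linarith [hφ.2]⟩)
  rw [Complex.exp_mem_slitPlane, (toIocMod_eq_self two_pi_pos).2
    ⟨by simpa using hφ.1, by simp; linarith [hφ.2]⟩]
  simpa using hφ.2.ne

theorem exists_cosMean_deriv (hK : ClassK u E) : ∃ J' : ℝ → ℝ, ∀ t,
    HasDerivAt (cosMean u) (J' t) t ∧
      HasDerivAt J' (cosMean u t / 4 - u (-(exp t : ℝ))) t ∧ 0 ≤ J' t := by
  have huc := hK.cont
  have hd : ∀ x : ℝ, HasDerivAt (fun φ : ℝ => φ / 2) (1 / 2) x := fun x =>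
    (hasDerivAt_id x).div_const 2
  obtain ⟨J', hJ'⟩ := stripMean_deriv hK.continuous_comp_exp (fun z hz => hK.harmonicAt_exp hz)
    (w := fun φ => cos (φ / 2)) (w' := fun φ => -sin (φ / 2) * (1 / 2))
    (w'' := fun φ => -(cos (φ / 2) * (1 / 2)) * (1 / 2))
    (fun x => (hd x).cos) (fun x => ((hd x).sin.neg).mul_const _)
    (by fun_prop) (by simp) (by simp [neg_div])
  have hsrc : ∀ t, stripSource (fun z => u (Complex.exp z)) (fun φ => -sin (φ / 2) * (1 / 2))
      (fun φ => -(cos (φ / 2) * (1 / 2)) * (1 / 2)) 1 t =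
      cosMean u t / 4 - u (-(exp t : ℝ)) := by
    intro t
    have h1 : stripMean (fun z => u (Complex.exp z)) (fun φ => -(cos (φ / 2) * (1 / 2)) * (1 / 2))
        1 t = -(cosMean u t / 4) := by
      rw [cosMean, stripMean, stripMean, ← intervalIntegral.integral_div,
        ← intervalIntegral.integral_neg]
      congr 1
      ext φ
      ring
    have h2 : Complex.exp (t + (1 * π : ℝ) * Complex.I) = -(exp t : ℝ) := by
      rw [cexp_add_one_mul_I, Complex.exp_pi_mul_I, mul_neg_one]
    have h3 : Complex.exp (t + (1 * -π : ℝ) * Complex.I) = -(exp t : ℝ) := by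
      rw [cexp_add_one_mul_I]
      push_cast
      rw [neg_mul, Complex.exp_neg, Complex.exp_pi_mul_I]
      norm_num
    rw [stripSource, h1, h2, h3, neg_div, sin_neg, sin_pi_div_two]
    ring
  simp only [hsrc] at hJ'
  have hmono : Monotone J' := by
    refine monotone_of_hasDerivAt_nonneg (fun t => (hJ' t).2) fun t => ?_
    have := hK.le_cosMean t
    simp only [Pi.zero_apply]
    linarith
  obtain ⟨M, hM⟩ := (isCompact_closedBall (0 : ℂ) 1).bddAbove_image hK.cont.continuousOn
  refine ⟨J', fun t => ⟨(hJ' t).1, (hJ' t).2, deriv_nonneg_of_monotone_of_bddAbove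
    (fun t => (hJ' t).1) hmono (M := 4 * M) (fun t ht => ?_) t⟩⟩
  refine hK.cosMean_le fun z hz => hM ⟨z, ?_, rfl⟩
  rw [mem_closedBall_zero_iff, hz]
  exact exp_le_one_iff.2 ht

/-- The growth estimate for the maximum modulus in terms of the logarithmic length of `E`. -/
theorem exists_integral_le_log_Bmax (hK : ClassK u E) : ∃ c : ℝ, ∀ r, 1 < r →
    (1 / 2) * ∫ x in {x : ℝ | 0 < x ∧ (-(x : ℂ)) ∈ E} ∩ Set.Ioo 1 r, 1 / x ≤
      log (Bmax u r) + c := by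
  have huc := hK.cont
  obtain ⟨J', hJ⟩ := hK.exists_cosMean_deriv
  set J := cosMean u with hJdef
  have hJ0 : ∀ t, 0 < J t := hK.cosMean_pos
  have hJc : Continuous J := continuous_iff_continuousAt.2 fun t => (hJ t).1.continuousAt
  have hJc' : Continuous J' := continuous_iff_continuousAt.2 fun t => (hJ t).2.1.continuousAt
  let W : ℝ → ℝ := fun t => J' t + J t / 2
  let W' : ℝ → ℝ := fun t => J t / 4 - u (-(exp t : ℝ)) + J' t / 2
  have hW : ∀ t, HasDerivAt W (W' t) t := fun t => (hJ t).2.1.add ((hJ t).1.div_const 2)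
  have hW0 : ∀ t, 0 < W t := fun t => by
    have := hJ0 t
    have := (hJ t).2.2
    simp only [W]
    linarith
  have hWc : Continuous W := by fun_prop
  have hWc' : Continuous W' := by fun_prop
  have hW'0 : ∀ t, 0 ≤ W' t := fun t => by
    have := hK.le_cosMean t
    have := (hJ t).2.2
    simp only [W']
    linarith
  have hW'le : ∀ t, W' t ≤ W t / 2 := fun t => by
    have := hK.nonneg (-(exp t : ℝ))
    simp only [W', W]
    linarith
  have hW'eq : ∀ t : ℝ, (-(exp t : ℝ) : ℂ) ∈ E → W' t = W t / 2 := fun t ht => by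
    have := hK.vanish _ ht
    simp only [W', W, this]
    ring
  have hJmono : Monotone J' := by
    refine monotone_of_hasDerivAt_nonneg (fun t => (hJ t).2.1) fun t => ?_
    have := hK.le_cosMean t
    simp only [Pi.zero_apply]
    linarith
  have hWJ : ∀ t, W (t - 1) ≤ J t := by
    intro t
    obtain ⟨x, hx, hx'⟩ := exists_hasDerivAt_eq_slope J J' (show t - 1 < t by linarith)
      hJc.continuousOn fun x _ => (hJ x).1
    rw [sub_sub_cancel, div_one] at hx'
    have := hJmono hx.1.le
    have := hJ0 (t - 1)
    simp only [W]
    linarith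
  have hlogd : ∀ t, HasDerivAt (fun t => log (W t)) (W' t / W t) t := fun t =>
    (hW t).log (hW0 t).ne'
  have hlogW : ∀ t, log (W t) ≤ log (J t) + 1 / 2 := by
    intro t
    have hanti : Antitone fun t => log (W t) - 1 / 2 * t := by
      refine antitone_of_hasDerivAt_nonpos
        (fun t => (hlogd t).sub ((hasDerivAt_id t).const_mul (1 / 2))) fun t => ?_
      have : W' t / W t ≤ 1 / 2 := by
        rw [div_le_iff₀ (hW0 t)]
        linarith [hW'le t]
      simp only [Pi.zero_apply]
      linarith
    have h1 := hanti (show t - 1 ≤ t by linarith)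
    have h2 := log_le_log (hW0 (t - 1)) (hWJ t)
    simp only at h1
    linarith
  refine ⟨log 4 + 1 / 2 - log (W 0), fun r hr => ?_⟩
  have hr0 : 0 < r := by linarith
  set S := {x : ℝ | 0 < x ∧ (-(x : ℂ)) ∈ E} with hS
  have hSm : MeasurableSet S :=
    measurableSet_Ioi.inter (hK.closed.preimage (by fun_prop : Continuous fun x : ℝ =>
      (-(x : ℂ)))).measurableSet
  let L' : ℝ → ℝ := fun x => W' (log x) / W (log x) * x⁻¹
  have hL : ∀ x, 0 < x → HasDerivAt (fun x => log (W (log x))) (L' x) x := fun x hx =>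
    (hlogd (log x)).comp x (hasDerivAt_log hx.ne')
  have hIcc : ∀ x ∈ Set.Icc 1 r, x ≠ 0 := fun x hx => by linarith [hx.1]
  have hL'c : ContinuousOn L' (Set.Icc 1 r) := by
    have hlogc : ContinuousOn log (Set.Icc 1 r) := continuousOn_log.mono hIcc
    exact ((hWc'.comp_continuousOn hlogc).div (hWc.comp_continuousOn hlogc)
      fun x _ => (hW0 _).ne').mul (continuousOn_inv₀.mono hIcc)
  have hL'i : IntegrableOn L' (Set.Ioo 1 r) :=
    (hL'c.integrableOn_Icc).mono_set Set.Ioo_subset_Icc_self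
  have hinv : IntegrableOn (fun x : ℝ => 1 / 2 * (1 / x)) (Set.Ioo 1 r) := by
    refine IntegrableOn.mono_set (ContinuousOn.integrableOn_Icc ?_) Set.Ioo_subset_Icc_self
    exact continuousOn_const.mul (continuousOn_const.div continuousOn_id hIcc)
  have h1 : ∫ x in S ∩ Set.Ioo 1 r, 1 / 2 * (1 / x) ≤ ∫ x in S ∩ Set.Ioo 1 r, L' x := by
    refine setIntegral_mono_on (hinv.mono_set Set.inter_subset_right)
      (hL'i.mono_set Set.inter_subset_right) (hSm.inter measurableSet_Ioo) fun x hx => ?_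
    have hE : (-(exp (log x) : ℝ) : ℂ) ∈ E := by
      rw [exp_log hx.1.1]
      exact hx.1.2
    have := (hW0 (log x)).ne'
    simp only [L', hW'eq _ hE]
    apply le_of_eq
    field_simp
  have h2 : ∫ x in S ∩ Set.Ioo 1 r, L' x ≤ ∫ x in Set.Ioo 1 r, L' x := by
    refine setIntegral_mono_set hL'i ?_ Set.inter_subset_right.eventuallyLE
    refine (ae_restrict_iff' measurableSet_Ioo).2 (Eventually.of_forall fun x hx => ?_)
    have h3 : 0 < x := by linarith [hx.1]
    exact mul_nonneg (div_nonneg (hW'0 _) (hW0 _).le) (inv_nonneg.2 h3.le)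
  have h3 : ∫ x in Set.Ioo 1 r, L' x = log (W (log r)) - log (W 0) := by
    rw [← integral_Ioc_eq_integral_Ioo, ← intervalIntegral.integral_of_le hr.le,
      intervalIntegral.integral_eq_sub_of_hasDerivAt (f := fun x => log (W (log x)))
      (fun x hx => hL x ?_) (hL'c.intervalIntegrable_of_Icc hr.le), log_one]
    rw [Set.uIcc_of_le hr.le] at hx
    linarith [hx.1]
  rw [integral_const_mul] at h1
  have h4 : J (log r) ≤ 4 * Bmax u r :=
    hK.cosMean_le fun z hz => le_Bmax hK.cont (by rw [hz, exp_log hr0])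
  have h5 := log_le_log (hJ0 (log r)) h4
  have hB : 0 < Bmax u r := by linarith [hJ0 (log r)]
  rw [log_mul (by norm_num) hB.ne'] at h5
  have h6 := hlogW (log r)
  linarith

end ClassK

/-- Comparison of upper and lower limits for real functions that are dominated up to a
vanishing error. -/
theorem limsup_liminf_half_le {f D h : ℝ → ℝ} (hh : Tendsto h atTop (nhds 0)) {A B : ℝ}
    (hf : ∀ᶠ r in atTop, f r ≤ A) (hD : ∀ᶠ r in atTop, 0 ≤ D r) (hDB : ∀ᶠ r in atTop, D r ≤ B)
    (hfD : ∀ᶠ r in atTop, (1 / 2) * D r ≤ f r + h r) :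
    (1 / 2) * limsup D atTop ≤ limsup f atTop ∧ (1 / 2) * liminf D atTop ≤ liminf f atTop := by
  have hfb : IsBoundedUnder (· ≤ ·) atTop f := isBoundedUnder_of_eventually_le hf
  have hDb : IsBoundedUnder (· ≥ ·) atTop D := isBoundedUnder_of_eventually_ge hD
  have hDb' : IsBoundedUnder (· ≤ ·) atTop D := isBoundedUnder_of_eventually_le hDB
  have hfb' : IsBoundedUnder (· ≥ ·) atTop f := by
    refine isBoundedUnder_of_eventually_ge (a := -1) ?_
    filter_upwards [hD, hfD, hh.eventually_lt_const zero_lt_one] with r h1 h2 h3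
    linarith
  constructor
  · refine le_of_forall_pos_le_add fun ε hε => ?_
    have h1 : ∀ᶠ r in atTop, f r < limsup f atTop + ε / 2 :=
      eventually_lt_of_limsup_lt (by linarith) hfb
    have h2 : limsup D atTop ≤ 2 * (limsup f atTop + ε) := by
      refine limsup_le_of_le hDb.isCoboundedUnder_le ?_
      filter_upwards [h1, hfD, hh.eventually_lt_const (half_pos hε)] with r h3 h4 h5
      linarith
    linarith
  · refine le_of_forall_pos_le_add fun ε hε => ?_
    have h1 : ∀ᶠ r in atTop, liminf D atTop - ε < D r :=
      eventually_lt_of_lt_liminf (by linarith) hDb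
    have h2 : (1 / 2) * liminf D atTop - ε ≤ liminf f atTop := by
      refine le_liminf_of_le hfb.isCoboundedUnder_ge ?_
      filter_upwards [h1, hfD, hh.eventually_lt_const (half_pos hε)] with r h3 h4 h5
      linarith
    linarith

theorem stmt14 (u : ℂ → ℝ) (E : Set ℂ) (hK : ClassK u E)
    (Estar : Set ℝ) (hEstar : Estar = {x : ℝ | 0 < x ∧ (-(x : ℂ)) ∈ E}) :
    limsup (fun r => Real.log (Bmax u r) / Real.log r) atTop ≥ (1/2) * upperLogDens Estar ∧
    liminf (fun r => Real.log (Bmax u r) / Real.log r) atTop ≥ (1/2) * lowerLogDens Estar := by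
  obtain ⟨c, hc⟩ := hK.exists_integral_le_log_Bmax
  obtain ⟨C, hC0, hC⟩ := hK.exists_growth
  rw [← hEstar] at hc
  have hf : ∀ r, exp 1 ≤ r → log (Bmax u r) / log r ≤ |log C| + 3 / 4 := by
    intro r hr
    have hr1 : 1 ≤ r := le_trans (by linarith [add_one_le_exp (1:ℝ)]) hr
    have hr0 : 0 < r := by linarith
    have hlog : 1 ≤ log r := by
      rw [le_log_iff_exp_le hr0]
      exact hr
    have hrn : ‖(r : ℂ)‖ = r := by rw [Complex.norm_real, norm_of_nonneg hr0.le]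
    have hB0 : 0 < Bmax u r := by
      refine lt_of_lt_of_le (hK.pos (r : ℂ) fun h => ?_) (le_Bmax hK.cont hrn)
      have := (hK.subNegAxis h).2
      rw [Complex.ofReal_re] at this
      linarith
    have hB : Bmax u r ≤ C * r ^ (3 / 4 : ℝ) := by
      refine csSup_le ⟨u r, r, by simpa using hrn, rfl⟩ ?_
      rintro _ ⟨z, hz, rfl⟩
      rw [mem_sphere_zero_iff_norm] at hz
      have := hC z (hz ▸ hr1)
      rwa [hz] at this
    have h1 := log_le_log hB0 hB
    rw [log_mul hC0.ne' (rpow_pos_of_pos hr0 _).ne', log_rpow hr0] at h1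
    rw [div_le_iff₀ (by linarith)]
    nlinarith [le_abs_self (log C), abs_nonneg (log C)]
  have hfD : ∀ r, exp 1 ≤ r → (1 / 2) * ((1 / log r) * ∫ t in Estar ∩ Set.Ioo 1 r, 1 / t) ≤
      log (Bmax u r) / log r + c / log r := by
    intro r hr
    have hr1 : 1 < r := lt_of_lt_of_le (by linarith [add_one_le_exp (1:ℝ)]) hr
    have hlog : 0 < log r := log_pos hr1
    rw [← add_div, le_div_iff₀ hlog]
    have := hc r hr1
    calc _ = 1 / 2 * ∫ t in Estar ∩ Set.Ioo 1 r, 1 / t := by field_simp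
      _ ≤ _ := this
  have hh : Tendsto (fun r => c / log r) atTop (nhds 0) :=
    tendsto_const_nhds.div_atTop tendsto_log_atTop
  refine limsup_liminf_half_le hh (A := |log C| + 3 / 4) (B := 2 * (|log C| + 3 / 4 + 1))
    ?_ ?_ ?_ ?_
  · filter_upwards [eventually_ge_atTop (exp 1)] with r hr using hf r hr
  · filter_upwards [eventually_ge_atTop 1] with r hr
    refine mul_nonneg (one_div_nonneg.2 (log_nonneg hr)) ?_
    rw [hEstar]
    refine integral_nonneg_of_ae (ae_restrict_of_forall_mem ?_ fun x hx => ?_)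
    · exact (measurableSet_Ioi.inter (hK.closed.preimage (by fun_prop : Continuous fun x : ℝ =>
        (-(x : ℂ)))).measurableSet).inter measurableSet_Ioo
    · exact one_div_nonneg.2 hx.1.1.le
  · filter_upwards [eventually_ge_atTop (exp 1), hh.eventually_lt_const zero_lt_one] with r hr h1
    linarith [hf r hr, hfD r hr]
  · filter_upwards [eventually_ge_atTop (exp 1)] with r hr using hfD r hr
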